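/- For every integer d ≥ 2 and every convex body K ⊆ ℝ^d of unit d-dimensional volume, the limit inferior of n^{-d} · EH^K_{d,d+1}(n) as n → ∞ is at least 2 / ((d−1)! · p_{d−1}). -/

import Mathlib

open MeasureTheory Filter

noncomputable section

abbrev Euc (d : ℕ) : Type := EuclideanSpace ℝ (Fin d)

/-- A convex body: compact convex set with nonempty interior. -/
def IsConvexBody {d : ℕ} (K : Set (Euc d)) : Prop :=
  Convex ℝ K ∧ IsCompact K ∧ (interior K).Nonempty

/-- A set of points is in convex position if no point lies in the convex
hull of the others. -/
def InConvexPosition {d : ℕ} (P : Set (Euc d)) : Prop :=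
  ∀ p ∈ P, p ∉ convexHull ℝ (P \ {p})

/-- `H` is a `k`-hole in `S`. -/
def IsHole {d : ℕ} (k : ℕ) (S H : Finset (Euc d)) : Prop :=
  H ⊆ S ∧ H.card = k ∧ InConvexPosition (H : Set (Euc d)) ∧
    ∀ p ∈ S, p ∉ interior (convexHull ℝ (H : Set (Euc d)))

open Classical in
/-- The number of `k`-holes in the point set given by `x`. -/
noncomputable def holeCount (d k n : ℕ) (x : Fin n → Euc d) : ℕ :=
  ((Finset.image x Finset.univ).powerset.filter
    (fun H => IsHole k (Finset.image x Finset.univ) H)).card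

/-- The uniform probability distribution on `K`. -/
noncomputable def unif {d : ℕ} (K : Set (Euc d)) : Measure (Euc d) :=
  (volume K)⁻¹ • volume.restrict K

/-- The expected number of `k`-holes among `n` points drawn uniformly and
independently at random from `K`. -/
noncomputable def EH (d k : ℕ) (K : Set (Euc d)) (n : ℕ) : ℝ :=
  ∫ x : Fin n → Euc d, (holeCount d k n x : ℝ) ∂(Measure.pi fun _ : Fin n => unif K)

/-- The probability that, for `d+2` points chosen uniformly and independently
at random from `K`, one of the points lies in the convex hull of the others. -/
noncomputable def pSimplex (d : ℕ) (K : Set (Euc d)) : ℝ :=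
  ((Measure.pi fun _ : Fin (d + 2) => unif K)
    {x : Fin (d + 2) → Euc d | ∃ i, x i ∈ convexHull ℝ (x '' {j | j ≠ i})}).toReal

/-- The maximum of `pSimplex d K` over all convex bodies `K ⊆ ℝ^d`. -/
noncomputable def pMax (d : ℕ) : ℝ :=
  sSup {p : ℝ | ∃ K : Set (Euc d), IsConvexBody K ∧ p = pSimplex d K}

end

open scoped ENNReal Topology

/-- Homogeneous coordinates of a point. -/
def homog {k : ℕ} (y : Fin k → ℝ) : Fin (k + 1) → ℝ := Fin.cons 1 y

/-- The determinant of the homogeneous coordinates of `k + 1` points in `ℝ^k`. -/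
def simplexDet {k : ℕ} (z : Fin (k + 1) → Fin k → ℝ) : ℝ :=
  (Matrix.of fun i => homog (z i)).det

/-- The point above `y` (in the direction of the coordinate `j`) at height `s` over the graph
of the affine function with coefficients `c`. -/
def graphLift {m : ℕ} (j : Fin (m + 1)) (c : Fin (m + 1) → ℝ) (s : ℝ) (y : Fin m → ℝ) :
    Fin (m + 1) → ℝ :=
  j.insertNth (s + homog y ⬝ᵥ c) y

lemma homog_insertNth {m : ℕ} (j : Fin (m + 1)) (t : ℝ) (y : Fin m → ℝ) :
    homog (j.insertNth t y : Fin (m + 1) → ℝ) =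
      (j.succ.insertNth t (homog y) : Fin (m + 2) → ℝ) := by
  symm
  rw [Fin.insertNth_eq_iff]
  refine ⟨by simp [homog], ?_⟩
  ext k
  refine Fin.cases ?_ (fun k => ?_) k
  · simp [homog, Fin.removeNth]
  · simp [homog, Fin.removeNth]

lemma simplexDet_cons_graphLift {m : ℕ} (j : Fin (m + 1)) (c : Fin (m + 1) → ℝ) (s : ℝ)
    (y₀ : Fin m → ℝ) (y : Fin (m + 1) → Fin m → ℝ) :
    simplexDet (Fin.cons (graphLift j c s y₀) fun i => graphLift j c 0 (y i)) =
      (-1) ^ (j.succ : ℕ) * (s * simplexDet y) := by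
  let s' : Fin (m + 2) → ℝ := Fin.cons s 0
  let y' : Fin (m + 2) → Fin m → ℝ := Fin.cons y₀ y
  let B : Matrix (Fin (m + 2)) (Fin (m + 2)) ℝ :=
    Matrix.of fun i => (j.succ.insertNth (s' i) (homog (y' i)) : Fin (m + 2) → ℝ)
  have hA : (Matrix.of fun i => homog ((Fin.cons (graphLift j c s y₀)
      fun i => graphLift j c 0 (y i) : Fin (m + 2) → Fin (m + 1) → ℝ) i)) =
      B.updateCol j.succ
        (fun k => ∑ i, ((j.succ.insertNth 1 c : Fin (m + 2) → ℝ) i) • B k i) := by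
    have hz : ∀ i, (Fin.cons (graphLift j c s y₀)
      fun i => graphLift j c 0 (y i) : Fin (m + 2) → Fin (m + 1) → ℝ) i =
        graphLift j c (s' i) (y' i) := by
      intro i
      refine Fin.cases ?_ (fun i => ?_) i <;> simp [s', y']
    ext i k
    refine (congrArg (fun v => homog v k) (hz i)).trans ?_
    simp only [graphLift, homog_insertNth]
    rcases Fin.eq_self_or_eq_succAbove j.succ k with rfl | ⟨l, rfl⟩
    · simp only [Fin.insertNth_apply_same, Matrix.updateCol_self]
      rw [Fin.sum_univ_succAbove _ j.succ]
      simp [B, dotProduct, mul_comm]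
    · rw [Matrix.updateCol_ne (Fin.succAbove_ne _ _)]
      simp [B]
  rw [simplexDet, hA, Matrix.det_updateCol_sum, Matrix.det_succ_column _ j.succ,
    Fin.sum_univ_succ]
  have h0 : (B.submatrix (Fin.succAbove 0) j.succ.succAbove) = Matrix.of fun i => homog (y i) := by
    ext i k
    simp [B, y']
  rw [h0]
  simp [B, s', simplexDet, mul_assoc]

lemma abs_simplexDet_cons_graphLift {m : ℕ} (j : Fin (m + 1)) (c : Fin (m + 1) → ℝ) (s : ℝ)
    (y₀ : Fin m → ℝ) (y : Fin (m + 1) → Fin m → ℝ) :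
    |simplexDet (Fin.cons (graphLift j c s y₀) fun i => graphLift j c 0 (y i))| =
      |s| * |simplexDet y| := by
  rw [simplexDet_cons_graphLift, abs_mul, abs_mul, abs_pow]
  simp

@[fun_prop]
lemma continuous_homog {k : ℕ} : Continuous (homog : (Fin k → ℝ) → Fin (k + 1) → ℝ) := by
  unfold homog
  refine continuous_pi fun i => ?_
  refine Fin.cases ?_ (fun i => ?_) i
  · simpa using continuous_const
  · simpa using continuous_apply i

@[fun_prop]
lemma continuous_simplexDet {k : ℕ} :
    Continuous (simplexDet : (Fin (k + 1) → Fin k → ℝ) → ℝ) := by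
  unfold simplexDet
  refine Continuous.matrix_det ?_
  refine continuous_matrix fun i j => ?_
  simp only [Matrix.of_apply]
  fun_prop

lemma Continuous.graphLift {X : Type*} [TopologicalSpace X] {m : ℕ} (j : Fin (m + 1))
    {c : X → Fin (m + 1) → ℝ} {s : X → ℝ} {y : X → Fin m → ℝ} (hc : Continuous c)
    (hs : Continuous s) (hy : Continuous y) :
    Continuous fun x => graphLift j (c x) (s x) (y x) := by
  unfold _root_.graphLift
  refine Continuous.finInsertNth j ?_ hy
  unfold dotProduct
  fun_prop

/-- Fibrewise linear change of variables: tuples of `m + 1` points in `ℝ^(m+1)` are parametrised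
by their projections `y` and by the hyperplane through them. -/
theorem lintegral_eq_lintegral_graphLift {m : ℕ} (j : Fin (m + 1))
    (hae : ∀ᵐ y : Fin (m + 1) → Fin m → ℝ, simplexDet y ≠ 0)
    {F : (Fin (m + 1) → Fin (m + 1) → ℝ) → ℝ≥0∞} (hF : Measurable F) :
    ∫⁻ x, F x = ∫⁻ y : Fin (m + 1) → Fin m → ℝ, ENNReal.ofReal |simplexDet y| *
      ∫⁻ c : Fin (m + 1) → ℝ, F fun i => graphLift j c 0 (y i) := by
  have e₁ := volume_preserving_pi (fun _ : Fin (m + 1) =>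
    (volume_preserving_piFinSuccAbove (fun _ : Fin (m + 1) => ℝ) j).symm)
  have e₂ := (volume_measurePreserving_arrowProdEquivProdArrow ℝ (Fin m → ℝ) (Fin (m + 1))).symm
  have e := e₁.comp e₂
  rw [← e.lintegral_comp hF, Measure.volume_eq_prod]
  refine (lintegral_prod_symm' _ (hF.comp e.measurable)).trans ?_
  refine lintegral_congr_ae ?_
  filter_upwards [hae] with y hy
  have hG : Measurable fun t : Fin (m + 1) → ℝ =>
      F fun i => (j.insertNth (t i) (y i) : Fin (m + 1) → ℝ) := by
    refine hF.comp (measurable_pi_lambda _ fun i => ?_)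
    refine Continuous.measurable ?_
    exact Continuous.finInsertNth j (by fun_prop) (by fun_prop)
  set M : Matrix (Fin (m + 1)) (Fin (m + 1)) ℝ := Matrix.of fun i => homog (y i)
  have hM : M.det ≠ 0 := hy
  have hmap := Real.map_matrix_volume_pi_eq_smul_volume_pi hM
  have key : ∫⁻ c : Fin (m + 1) → ℝ, F (fun i => graphLift j c 0 (y i)) =
      ENNReal.ofReal |M.det⁻¹| * ∫⁻ t : Fin (m + 1) → ℝ,
        F fun i => (j.insertNth (t i) (y i) : Fin (m + 1) → ℝ) := by
    rw [← smul_eq_mul, ← lintegral_smul_measure, ← hmap, lintegral_map hG]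
    · simp [graphLift, M, Matrix.toLin'_apply, Matrix.mulVec]
    · exact (LinearMap.continuous_of_finiteDimensional _).measurable
  rw [key, ← mul_assoc, ← ENNReal.ofReal_mul (abs_nonneg _), ← abs_mul]
  change _ = ENNReal.ofReal |M.det * _| * _
  rw [mul_inv_cancel₀ hM]
  simp only [abs_one, ENNReal.ofReal_one, one_mul]
  rfl

lemma lintegral_cons_eq {m : ℕ} {F : (Fin (m + 2) → Fin (m + 1) → ℝ) → ℝ≥0∞} (hF : Measurable F) :
    ∫⁻ z, F z = ∫⁻ x : Fin (m + 1) → Fin (m + 1) → ℝ, ∫⁻ x₀ : Fin (m + 1) → ℝ,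
      F (Fin.cons x₀ x) := by
  have e := (volume_preserving_piFinSuccAbove
    (fun _ : Fin (m + 2) => Fin (m + 1) → ℝ) 0).symm
  rw [← e.lintegral_comp hF, Measure.volume_eq_prod]
  refine (lintegral_prod_symm' _ (hF.comp e.measurable)).trans ?_
  refine lintegral_congr fun x => lintegral_congr fun x₀ => ?_
  exact congrArg F (Fin.insertNth_zero' x₀ x)

lemma lintegral_insertNth_eq {m : ℕ} (j : Fin (m + 1)) (c : Fin (m + 1) → ℝ)
    {F : (Fin (m + 1) → ℝ) → ℝ≥0∞} (hF : Measurable F) :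
    ∫⁻ x, F x = ∫⁻ y : Fin m → ℝ, ∫⁻ s : ℝ, F (graphLift j c s y) := by
  have e := (volume_preserving_piFinSuccAbove (fun _ : Fin (m + 1) => ℝ) j).symm
  rw [← e.lintegral_comp hF, Measure.volume_eq_prod]
  refine (lintegral_prod_symm' _ (hF.comp e.measurable)).trans ?_
  refine lintegral_congr fun y => ?_
  exact (lintegral_add_right_eq_self (fun t => F (j.insertNth t y)) (homog y ⬝ᵥ c)).symm

lemma continuous_finCons {m : ℕ} {X : Type*} [TopologicalSpace X] :
    Continuous fun p : X × (Fin m → X) => (Fin.cons p.1 p.2 : Fin (m + 1) → X) := by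
  refine continuous_pi fun i => ?_
  refine Fin.cases ?_ (fun i => ?_) i
  · simpa using continuous_fst
  · exact (continuous_apply i).comp continuous_snd

/-- Tuples of `m + 2` points in `ℝ^(m+1)`, parametrised by the hyperplane `c` through the last
`m + 1` of them, their projections `y`, and the projection `y₀` and vertical distance `s`
of the first one. -/
theorem lintegral_cons_eq_lintegral_graphLift {m : ℕ} (j : Fin (m + 1))
    (hae : ∀ᵐ y : Fin (m + 1) → Fin m → ℝ, simplexDet y ≠ 0)
    {F : (Fin (m + 2) → Fin (m + 1) → ℝ) → ℝ≥0∞} (hF : Measurable F) :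
    ∫⁻ z, F z = ∫⁻ y : Fin (m + 1) → Fin m → ℝ, ENNReal.ofReal |simplexDet y| *
      ∫⁻ c : Fin (m + 1) → ℝ, ∫⁻ y₀ : Fin m → ℝ, ∫⁻ s : ℝ,
        F (Fin.cons (graphLift j c s y₀) fun i => graphLift j c 0 (y i)) := by
  have hF' : Measurable fun p : (Fin (m + 1) → Fin (m + 1) → ℝ) × (Fin (m + 1) → ℝ) =>
      F (Fin.cons p.2 p.1) :=
    hF.comp (continuous_finCons.comp continuous_swap).measurable
  rw [lintegral_cons_eq hF, lintegral_eq_lintegral_graphLift j hae hF'.lintegral_prod_right']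
  refine lintegral_congr fun y => ?_
  congr 1
  refine lintegral_congr fun c => ?_
  exact lintegral_insertNth_eq j c
    (F := fun x₀ => F (Fin.cons x₀ fun i => graphLift j c 0 (y i)))
    (hF'.comp measurable_prodMk_left)

theorem ae_simplexDet_ne_zero (k : ℕ) :
    ∀ᵐ z : Fin (k + 1) → Fin k → ℝ, simplexDet z ≠ 0 := by
  induction k with
  | zero => exact Eventually.of_forall fun z => by simp [simplexDet, homog]
  | succ m ih =>
    have hms : MeasurableSet {z : Fin (m + 2) → Fin (m + 1) → ℝ | simplexDet z = 0} :=
      (isClosed_eq continuous_simplexDet continuous_const).measurableSet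
    rw [ae_iff]
    simp only [ne_eq, not_not]
    rw [← lintegral_indicator_one hms,
      lintegral_cons_eq_lintegral_graphLift 0 ih (measurable_one.indicator hms)]
    refine lintegral_eq_zero_of_ae_eq_zero ?_
    filter_upwards [ih] with y hy
    simp only [Pi.zero_apply, mul_eq_zero]
    right
    simp only [Set.indicator_apply, Set.mem_ofPred_eq, simplexDet_cons_graphLift, mul_eq_zero, hy]
    simp only [pow_eq_zero_iff', neg_eq_zero, one_ne_zero, false_and, or_false, false_or,
      Pi.one_apply]
    have : ∫⁻ s : ℝ, (if s = 0 then (1 : ℝ≥0∞) else 0) = 0 := by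
      refine lintegral_eq_zero_of_ae_eq_zero ?_
      filter_upwards [Measure.ae_ne volume (0 : ℝ)] with s hs
      simp [hs]
    simp [this]

lemma lintegral_exp_neg_mul_abs {a : ℝ} (ha : 0 < a) :
    ∫⁻ s : ℝ, ENNReal.ofReal (Real.exp (-(a * |s|))) = ENNReal.ofReal (2 / a) := by
  have h1 : ∫ s : ℝ, Real.exp (-(a * |s|)) = 2 / a := by
    rw [integral_comp_abs (f := fun s => Real.exp (-(a * s)))]
    have := integral_exp_mul_Ioi (a := -a) (by linarith) 0
    simp only [neg_mul] at this
    rw [this]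
    simp
    ring
  rw [← h1, ofReal_integral_eq_lintegral_ofReal]
  · refine Integrable.of_integral_ne_zero ?_
    rw [h1]
    positivity
  · exact Eventually.of_forall fun s => (Real.exp_pos _).le

lemma mul_lintegral_eq_lintegral_div {N : ℕ} (hN : N ≠ 0) {g : ℝ → ℝ≥0∞} (hg : Measurable g) :
    (N : ℝ≥0∞) * ∫⁻ s, g s = ∫⁻ u, g (u / N) := by
  have hN' : (0 : ℝ) < N := by positivity
  have hmap := Real.map_volume_mul_left (a := (N : ℝ)⁻¹) (by positivity)
  have h : ∫⁻ u, g (u / N) = ∫⁻ u, g u ∂(Measure.map ((N : ℝ)⁻¹ * ·) volume) := by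
    rw [lintegral_map hg (by fun_prop)]
    simp [div_eq_inv_mul]
  rw [h, hmap, lintegral_smul_measure, inv_inv, abs_of_pos hN', smul_eq_mul, ENNReal.ofReal_natCast]

lemma lintegral_prod_four {A B C D : Type*} [MeasureSpace A] [MeasureSpace B] [MeasureSpace C]
    [MeasureSpace D] [SigmaFinite (volume : Measure A)] [SigmaFinite (volume : Measure B)]
    [SigmaFinite (volume : Measure C)] [SigmaFinite (volume : Measure D)]
    {G : A × B × C × D → ℝ≥0∞} (hG : Measurable G) :
    ∫⁻ p, G p = ∫⁻ a, ∫⁻ b, ∫⁻ c, ∫⁻ d, G (a, b, c, d) := by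
  rw [Measure.volume_eq_prod, lintegral_prod _ hG.aemeasurable]
  refine lintegral_congr fun a => ?_
  have h1 : Measurable fun p : B × C × D => G (a, p) := hG.comp measurable_prodMk_left
  rw [Measure.volume_eq_prod, lintegral_prod _ h1.aemeasurable]
  refine lintegral_congr fun b => ?_
  have h2 : Measurable fun p : C × D => G (a, b, p) := h1.comp measurable_prodMk_left
  rw [Measure.volume_eq_prod, lintegral_prod _ h2.aemeasurable]

/-- The probability density, at the tuple `z` of points of `U`, of the event that `N` further
independent points miss the simplex spanned by `z`. -/
noncomputable def emptyDensity {d : ℕ} (U : Set (Fin d → ℝ)) (N : ℕ) (z : Fin (d + 1) → Fin d → ℝ) :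
    ℝ≥0∞ :=
  Set.indicator {z | ∀ i, z i ∈ U}
    (fun z => ENNReal.ofReal (1 - |simplexDet z| / d.factorial) ^ N) z

lemma measurable_emptyDensity {d : ℕ} {U : Set (Fin d → ℝ)} (hU : MeasurableSet U) (N : ℕ) :
    Measurable (emptyDensity U N) := by
  unfold emptyDensity
  refine Measurable.indicator ?_ ?_
  · refine Measurable.pow_const (ENNReal.measurable_ofReal.comp ?_) N
    exact (by fun_prop : Continuous fun z : Fin (d + 1) → Fin d → ℝ =>
      1 - |simplexDet z| / (d.factorial : ℝ)).measurable
  · have : {z : Fin (d + 1) → Fin d → ℝ | ∀ i, z i ∈ U} = Set.pi Set.univ fun _ => U := by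
      ext; simp
    rw [this]
    exact MeasurableSet.univ_pi fun _ => hU

/-- The projection along the coordinate `j` of the section of `U` by the graph of `c`. -/
def graphSection {m : ℕ} (j : Fin (m + 1)) (U : Set (Fin (m + 1) → ℝ)) (c : Fin (m + 1) → ℝ) :
    Set (Fin m → ℝ) :=
  {y | graphLift j c 0 y ∈ U}

lemma continuous_cons_graphLift {m : ℕ} (j : Fin (m + 1)) (a : ℝ) :
    Continuous fun p : (Fin (m + 1) → Fin m → ℝ) × (Fin (m + 1) → ℝ) × (Fin m → ℝ) × ℝ =>
      (Fin.cons (graphLift j p.2.1 (p.2.2.2 / a) p.2.2.1)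
        fun i => graphLift j p.2.1 0 (p.1 i) : Fin (m + 2) → Fin (m + 1) → ℝ) := by
  refine continuous_finCons.comp (Continuous.prodMk ?_ ?_)
  · exact Continuous.graphLift j (by fun_prop) (by fun_prop) (by fun_prop)
  · exact continuous_pi fun i => Continuous.graphLift j (by fun_prop) (by fun_prop) (by fun_prop)

lemma measurableSet_graphSection_prod {m : ℕ} (j : Fin (m + 1)) {U : Set (Fin (m + 1) → ℝ)}
    (hU : MeasurableSet U) :
    MeasurableSet {p : (Fin m → ℝ) × (Fin (m + 1) → ℝ) | p.1 ∈ graphSection j U p.2} := by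
  have hc : Continuous fun p : (Fin m → ℝ) × (Fin (m + 1) → ℝ) => graphLift j p.2 0 p.1 :=
    Continuous.graphLift j (by fun_prop) (by fun_prop) (by fun_prop)
  exact hc.measurable hU

lemma measurableSet_graphSection {m : ℕ} (j : Fin (m + 1)) {U : Set (Fin (m + 1) → ℝ)}
    (hU : MeasurableSet U) (c : Fin (m + 1) → ℝ) : MeasurableSet (graphSection j U c) :=
  (measurableSet_graphSection_prod j hU).preimage measurable_prodMk_right

lemma measurableSet_forall_graphSection {m : ℕ} (j : Fin (m + 1)) {U : Set (Fin (m + 1) → ℝ)}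
    (hU : MeasurableSet U) :
    MeasurableSet {p : (Fin (m + 1) → Fin m → ℝ) × (Fin (m + 1) → ℝ) |
      ∀ i, p.1 i ∈ graphSection j U p.2} := by
  have : {p : (Fin (m + 1) → Fin m → ℝ) × (Fin (m + 1) → ℝ) |
      ∀ i, p.1 i ∈ graphSection j U p.2} = ⋂ i, (fun p => (p.1 i, p.2)) ⁻¹'
      {p : (Fin m → ℝ) × (Fin (m + 1) → ℝ) | p.1 ∈ graphSection j U p.2} := by
    ext; simp
  rw [this]
  exact MeasurableSet.iInter fun i => (by fun_prop : Measurable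
    fun p : (Fin (m + 1) → Fin m → ℝ) × (Fin (m + 1) → ℝ) => (p.1 i, p.2))
      (measurableSet_graphSection_prod j hU)

lemma natCast_mul_lintegral_emptyDensity {m : ℕ} (j : Fin (m + 1)) {U : Set (Fin (m + 1) → ℝ)}
    (hU : MeasurableSet U) {N : ℕ} (hN : N ≠ 0) :
    N * ∫⁻ z, emptyDensity U N z =
      ∫⁻ p : (Fin (m + 1) → Fin m → ℝ) × (Fin (m + 1) → ℝ) × (Fin m → ℝ) × ℝ,
        ENNReal.ofReal |simplexDet p.1| *
          emptyDensity U N (Fin.cons (graphLift j p.2.1 (p.2.2.2 / N) p.2.2.1)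
            fun i => graphLift j p.2.1 0 (p.1 i)) := by
  have hE := measurable_emptyDensity hU N
  have hD : Measurable fun y : Fin (m + 1) → Fin m → ℝ => ENNReal.ofReal |simplexDet y| :=
    ENNReal.measurable_ofReal.comp (by fun_prop : Continuous _).measurable
  have hG : Measurable fun p : (Fin (m + 1) → Fin m → ℝ) × (Fin (m + 1) → ℝ) × (Fin m → ℝ) × ℝ =>
        emptyDensity U N (Fin.cons (graphLift j p.2.1 (p.2.2.2 / N) p.2.2.1)
            fun i => graphLift j p.2.1 0 (p.1 i)) :=
    hE.comp (continuous_cons_graphLift j N).measurable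
  have hG1 : Measurable fun p : (Fin (m + 1) → Fin m → ℝ) × (Fin (m + 1) → ℝ) × (Fin m → ℝ) × ℝ =>
        emptyDensity U N (Fin.cons (graphLift j p.2.1 (p.2.2.2) p.2.2.1)
            fun i => graphLift j p.2.1 0 (p.1 i)) := by
    have := (continuous_cons_graphLift j 1).measurable
    simp only [div_one] at this
    exact hE.comp this
  rw [lintegral_prod_four (by exact (hD.comp measurable_fst).mul hG),
    lintegral_cons_eq_lintegral_graphLift j (ae_simplexDet_ne_zero m) hE]
  rw [← lintegral_const_mul' _ _ (by simp)]
  refine lintegral_congr fun y => ?_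
  have hGy := hG1.comp (measurable_prodMk_left (x := y))
  rw [mul_left_comm, ← lintegral_const_mul' _ _ (by simp), ← lintegral_const_mul' _ _ (by simp)]
  refine lintegral_congr fun c => ?_
  have hGc := hGy.comp (measurable_prodMk_left (x := c))
  rw [← lintegral_const_mul' _ _ (by simp), ← lintegral_const_mul' _ _ (by simp)]
  refine lintegral_congr fun y₀ => ?_
  rw [mul_lintegral_eq_lintegral_div hN (g := fun s => emptyDensity U N
    (Fin.cons (graphLift j c s y₀) fun i => graphLift j c 0 (y i)))
    (hGc.comp (measurable_prodMk_left (x := y₀))), ← lintegral_const_mul' _ _ (by simp)]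

lemma emptyDensity_cons_graphLift {m : ℕ} (j : Fin (m + 1)) (U : Set (Fin (m + 1) → ℝ)) (N : ℕ)
    (c : Fin (m + 1) → ℝ) (s : ℝ) (y₀ : Fin m → ℝ) (y : Fin (m + 1) → Fin m → ℝ) :
    emptyDensity U N (Fin.cons (graphLift j c s y₀) fun i => graphLift j c 0 (y i)) =
      Set.indicator {s | graphLift j c s y₀ ∈ U ∧ ∀ i, y i ∈ graphSection j U c}
        (fun s => ENNReal.ofReal
          (1 - |s| * |simplexDet y| / (m + 1).factorial) ^ N) s := by
  classical
  unfold emptyDensity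
  simp only [Set.indicator_apply, Set.mem_ofPred_eq, abs_simplexDet_cons_graphLift,
    Fin.forall_fin_succ (n := m + 1), Fin.cons_zero, Fin.cons_succ, graphSection]

lemma tendsto_emptyDensity_graphLift {m : ℕ} (j : Fin (m + 1)) {U : Set (Fin (m + 1) → ℝ)}
    (hU : IsOpen U) {c : Fin (m + 1) → ℝ} (s : ℝ) {y₀ : Fin m → ℝ} {y : Fin (m + 1) → Fin m → ℝ}
    (hy₀ : y₀ ∈ graphSection j U c) (hy : ∀ i, y i ∈ graphSection j U c) :
    Tendsto (fun N : ℕ => emptyDensity U N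
      (Fin.cons (graphLift j c (s / N) y₀) fun i => graphLift j c 0 (y i))) atTop
      (𝓝 (ENNReal.ofReal
        (Real.exp (-(|simplexDet y| / (m + 1).factorial * |s|))))) := by
  have hcont : Continuous fun s : ℝ => graphLift j c s y₀ :=
    Continuous.graphLift j (by fun_prop) (by fun_prop) (by fun_prop)
  have hs : Tendsto (fun N : ℕ => s / N) atTop (𝓝 0) := tendsto_const_div_atTop_nhds_zero_nat s
  have hev : ∀ᶠ N : ℕ in atTop, graphLift j c (s / N) y₀ ∈ U :=
    (hcont.tendsto 0).comp hs (hU.mem_nhds hy₀)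
  have hexp := Real.tendsto_one_add_div_pow_exp
    (-(|simplexDet y| / (m + 1).factorial * |s|))
  have hle : Tendsto (fun N : ℕ => (-(|simplexDet y| / (m + 1).factorial * |s|)) / (N : ℝ)) atTop
      (𝓝 0) := tendsto_const_div_atTop_nhds_zero_nat _
  refine (ENNReal.tendsto_ofReal hexp).congr' ?_
  filter_upwards [hev, hle.eventually (lt_mem_nhds (show (-1 : ℝ) < 0 by norm_num)),
    eventually_gt_atTop 0] with N hN hN1 hN0
  rw [emptyDensity_cons_graphLift, Set.indicator_of_mem (by exact ⟨hN, hy⟩),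
    ENNReal.ofReal_pow (by linarith)]
  congr 2
  rw [abs_div, Nat.abs_cast]
  ring

theorem le_liminf_natCast_mul_lintegral_emptyDensity {m : ℕ} (j : Fin (m + 1))
    {U : Set (Fin (m + 1) → ℝ)} (hU : IsOpen U) :
    ENNReal.ofReal (2 * (m + 1).factorial) *
        ∫⁻ c : Fin (m + 1) → ℝ, volume (graphSection j U c) ^ (m + 2) ≤
      liminf (fun N : ℕ => N * ∫⁻ z, emptyDensity U N z) atTop := by
  classical
  have hUm := hU.measurableSet
  let W : Set ((Fin (m + 1) → Fin m → ℝ) × (Fin (m + 1) → ℝ) × (Fin m → ℝ) × ℝ) :=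
    {p | p.2.2.1 ∈ graphSection j U p.2.1 ∧ ∀ i, p.1 i ∈ graphSection j U p.2.1}
  have hW : MeasurableSet W :=
    ((by fun_prop : Measurable fun p : (Fin (m + 1) → Fin m → ℝ) × (Fin (m + 1) → ℝ) ×
      (Fin m → ℝ) × ℝ => (p.2.2.1, p.2.1)) (measurableSet_graphSection_prod j hUm)).inter
    ((by fun_prop : Measurable fun p : (Fin (m + 1) → Fin m → ℝ) × (Fin (m + 1) → ℝ) ×
      (Fin m → ℝ) × ℝ => (p.1, p.2.1)) (measurableSet_forall_graphSection j hUm))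
  let G : (Fin (m + 1) → Fin m → ℝ) × (Fin (m + 1) → ℝ) × (Fin m → ℝ) × ℝ → ℝ≥0∞ :=
    W.indicator fun p => ENNReal.ofReal |simplexDet p.1| *
      ENNReal.ofReal (Real.exp (-(|simplexDet p.1| / (m + 1).factorial * |p.2.2.2|)))
  have hGm : Measurable G := by
    refine Measurable.indicator ?_ hW
    refine Measurable.mul (?_ : Measurable fun p => ENNReal.ofReal _)
      (?_ : Measurable fun p => ENNReal.ofReal _) <;>
    exact ENNReal.measurable_ofReal.comp (by fun_prop : Continuous _).measurable
  have hlhs : ENNReal.ofReal (2 * (m + 1).factorial) *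
      ∫⁻ c : Fin (m + 1) → ℝ, volume (graphSection j U c) ^ (m + 2) = ∫⁻ p, G p := by
    rw [lintegral_prod_four hGm]
    let g : (Fin (m + 1) → Fin m → ℝ) → (Fin (m + 1) → ℝ) → ℝ≥0∞ := fun y c =>
      Set.indicator {p : (Fin (m + 1) → Fin m → ℝ) × (Fin (m + 1) → ℝ) |
        ∀ i, p.1 i ∈ graphSection j U p.2} 
        (fun p => ENNReal.ofReal (2 * (m + 1).factorial) * volume (graphSection j U p.2)) (y, c)
    have hvol : Measurable fun c => volume (graphSection j U c) :=
      measurable_measure_prodMk_right (measurableSet_graphSection_prod j hUm)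
    have hg : Measurable (Function.uncurry g) := by
      refine Measurable.indicator ?_ (measurableSet_forall_graphSection j hUm)
      exact (hvol.comp measurable_snd).const_mul _
    have h1 : ∫⁻ y, ∫⁻ c, ∫⁻ y₀, ∫⁻ s, G (y, c, y₀, s) = ∫⁻ y, ∫⁻ c, g y c := by
      refine lintegral_congr_ae ?_
      filter_upwards [ae_simplexDet_ne_zero m] with y hy
      refine lintegral_congr fun c => ?_
      have hs : ∀ y₀, ∫⁻ s, G (y, c, y₀, s) =
          Set.indicator (graphSection j U c) (fun _ => if ∀ i, y i ∈ graphSection j U c then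
            ENNReal.ofReal (2 * (m + 1).factorial) else 0) y₀ := by
        intro y₀
        have hpos : 0 < |simplexDet y| := abs_pos.mpr hy
        have hl : ∫⁻ s : ℝ, ENNReal.ofReal |simplexDet y| *
            ENNReal.ofReal (Real.exp (-(|simplexDet y| / (m + 1).factorial * |s|))) =
            ENNReal.ofReal (2 * (m + 1).factorial) := by
          rw [lintegral_const_mul' _ _ (by simp), lintegral_exp_neg_mul_abs (by positivity),
            ← ENNReal.ofReal_mul (abs_nonneg _)]
          congr 1
          field_simp
        by_cases h0 : y₀ ∈ graphSection j U c <;> by_cases h : ∀ i, y i ∈ graphSection j U c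
        · simp only [G, W, Set.indicator_apply, Set.mem_ofPred_eq, h0, h, true_and, if_true,
            implies_true]
          exact hl
        all_goals simp [G, W, h0, h]
      simp only [hs]
      rw [lintegral_indicator (measurableSet_graphSection j hUm c), setLIntegral_const]
      simp only [g, Set.indicator_apply, Set.mem_ofPred_eq]
      split_ifs <;> simp
    rw [h1, lintegral_lintegral_swap hg.aemeasurable,
      ← lintegral_const_mul' _ _ ENNReal.ofReal_ne_top]
    refine lintegral_congr fun c => ?_
    have hpi : {y : Fin (m + 1) → Fin m → ℝ | ∀ i, y i ∈ graphSection j U c} =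
        Set.pi Set.univ fun _ => graphSection j U c := by ext; simp
    have hset : MeasurableSet {y : Fin (m + 1) → Fin m → ℝ | ∀ i, y i ∈ graphSection j U c} := by
      rw [hpi]
      exact MeasurableSet.univ_pi fun _ => measurableSet_graphSection j hUm c
    have hgc : (fun y => g y c) = Set.indicator {y | ∀ i, y i ∈ graphSection j U c}
        fun _ => ENNReal.ofReal (2 * (m + 1).factorial) * volume (graphSection j U c) := by
      ext y; simp [g, Set.indicator_apply]
    rw [hgc, lintegral_indicator hset, setLIntegral_const, hpi, volume_pi_pi]
    simp only [Finset.prod_const, Finset.card_univ, Fintype.card_fin]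
    ring
  rw [hlhs]
  have hev : (fun N : ℕ => (N : ℝ≥0∞) * ∫⁻ z, emptyDensity U N z) =ᶠ[atTop] fun N : ℕ =>
      ∫⁻ p : (Fin (m + 1) → Fin m → ℝ) × (Fin (m + 1) → ℝ) × (Fin m → ℝ) × ℝ,
        ENNReal.ofReal |simplexDet p.1| *
          emptyDensity U N (Fin.cons (graphLift j p.2.1 (p.2.2.2 / N) p.2.2.1)
            fun i => graphLift j p.2.1 0 (p.1 i)) := by
    filter_upwards [eventually_ne_atTop 0] with N hN
    exact natCast_mul_lintegral_emptyDensity j hUm hN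
  rw [liminf_congr hev]
  refine le_trans (lintegral_mono fun p => ?_) (lintegral_liminf_le fun N => ?_)
  · by_cases hp : p ∈ W
    · simp only [G, Set.indicator_of_mem hp]
      refine (ENNReal.Tendsto.const_mul
        (tendsto_emptyDensity_graphLift j hU p.2.2.2 hp.1 hp.2) (Or.inr (by simp))).liminf_eq.ge
    · simp [G, Set.indicator_of_notMem hp]
  · refine Measurable.mul ?_ ((measurable_emptyDensity hUm N).comp
      (continuous_cons_graphLift j N).measurable)
    exact ENNReal.measurable_ofReal.comp (by fun_prop : Continuous _).measurable

/-- The coefficient of the `k`-th coordinate in the equation of the hyperplane through `x`. -/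
def hyperplaneCoeff {m : ℕ} (x : Fin (m + 1) → Fin (m + 1) → ℝ) (k : Fin (m + 1)) : ℝ :=
  simplexDet (Fin.cons (Pi.single k 1) x) - simplexDet (Fin.cons 0 x)

lemma continuous_hyperplaneCoeff {m : ℕ} (k : Fin (m + 1)) :
    Continuous fun x : Fin (m + 1) → Fin (m + 1) → ℝ => hyperplaneCoeff x k := by
  unfold hyperplaneCoeff
  exact (continuous_simplexDet.comp (continuous_finCons.comp
      (Continuous.prodMk continuous_const continuous_id))).sub
    (continuous_simplexDet.comp (continuous_finCons.comp
      (Continuous.prodMk continuous_const continuous_id)))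

lemma homog_dotProduct {m : ℕ} (y : Fin m → ℝ) (c : Fin (m + 1) → ℝ) :
    homog y ⬝ᵥ c = c 0 + ∑ k, y k * c k.succ := by
  simp [homog, dotProduct, Fin.sum_univ_succ]

lemma zero_eq_graphLift {m : ℕ} (j : Fin (m + 1)) (c : Fin (m + 1) → ℝ) :
    (0 : Fin (m + 1) → ℝ) = graphLift j c (-c 0) 0 := by
  symm
  rw [graphLift, Fin.insertNth_eq_iff]
  exact ⟨by simp [homog_dotProduct], by ext; simp [Fin.removeNth]⟩

lemma single_self_eq_graphLift {m : ℕ} (j : Fin (m + 1)) (c : Fin (m + 1) → ℝ) :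
    (Pi.single j 1 : Fin (m + 1) → ℝ) = graphLift j c (1 - c 0) 0 := by
  symm
  rw [graphLift, Fin.insertNth_eq_iff]
  exact ⟨by simp [homog_dotProduct], by ext; simp [Fin.removeNth]⟩

lemma single_succAbove_eq_graphLift {m : ℕ} (j : Fin (m + 1)) (c : Fin (m + 1) → ℝ) (k : Fin m) :
    (Pi.single (j.succAbove k) 1 : Fin (m + 1) → ℝ) =
      graphLift j c (-(c 0 + c k.succ)) (Pi.single k 1) := by
  symm
  rw [graphLift, Fin.insertNth_eq_iff]
  refine ⟨?_, ?_⟩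
  · simp [homog_dotProduct, Pi.single_apply]
  · ext l
    simp [Fin.removeNth, Pi.single_apply]

lemma abs_hyperplaneCoeff_self {m : ℕ} (j : Fin (m + 1)) (c : Fin (m + 1) → ℝ)
    (y : Fin (m + 1) → Fin m → ℝ) :
    |hyperplaneCoeff (fun i => graphLift j c 0 (y i)) j| = |simplexDet y| := by
  rw [hyperplaneCoeff, single_self_eq_graphLift j c, zero_eq_graphLift j c,
    simplexDet_cons_graphLift, simplexDet_cons_graphLift, ← mul_sub, ← sub_mul, abs_mul, abs_pow]
  simp

lemma abs_hyperplaneCoeff_succAbove {m : ℕ} (j : Fin (m + 1)) (c : Fin (m + 1) → ℝ)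
    (y : Fin (m + 1) → Fin m → ℝ) (k : Fin m) :
    |hyperplaneCoeff (fun i => graphLift j c 0 (y i)) (j.succAbove k)| =
      |c k.succ| * |simplexDet y| := by
  rw [hyperplaneCoeff, single_succAbove_eq_graphLift j c, zero_eq_graphLift j c,
    simplexDet_cons_graphLift, simplexDet_cons_graphLift, ← mul_sub, ← sub_mul, abs_mul, abs_pow]
  simp

/-- The tuples for which the `j`-th coordinate of the hyperplane normal dominates. -/
def dominatedBy {m : ℕ} (j : Fin (m + 1)) : Set (Fin (m + 1) → Fin (m + 1) → ℝ) :=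
  {x | ∀ k, |hyperplaneCoeff x k| ≤ |hyperplaneCoeff x j|}

lemma isClosed_dominatedBy {m : ℕ} (j : Fin (m + 1)) : IsClosed (dominatedBy j) := by
  have : (dominatedBy j : Set (Fin (m + 1) → Fin (m + 1) → ℝ)) =
      ⋂ k, {x | |hyperplaneCoeff x k| ≤ |hyperplaneCoeff x j|} := by
    ext; simp [dominatedBy]
  rw [this]
  exact isClosed_iInter fun k => isClosed_le (continuous_hyperplaneCoeff k).abs
    (continuous_hyperplaneCoeff j).abs

lemma exists_mem_dominatedBy {m : ℕ} (x : Fin (m + 1) → Fin (m + 1) → ℝ) :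
    ∃ j, x ∈ dominatedBy j := by
  obtain ⟨j, -, hj⟩ := Finset.exists_max_image Finset.univ (fun k => |hyperplaneCoeff x k|)
    Finset.univ_nonempty
  exact ⟨j, fun k => hj k (Finset.mem_univ k)⟩

lemma abs_coeff_le_of_mem_dominatedBy {m : ℕ} {j : Fin (m + 1)} {c : Fin (m + 1) → ℝ}
    {y : Fin (m + 1) → Fin m → ℝ} {R : ℝ} (hR : 0 ≤ R) (hD : simplexDet y ≠ 0)
    (hx : (fun i => graphLift j c 0 (y i)) ∈ dominatedBy j)
    (hb : ∀ i k, |graphLift j c 0 (y i) k| ≤ R) (l : Fin (m + 1)) :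
    |c l| ≤ 1 + (m + 1) * R := by
  have hsucc : ∀ k : Fin m, |c k.succ| ≤ 1 := by
    intro k
    have := hx (j.succAbove k)
    rw [abs_hyperplaneCoeff_self, abs_hyperplaneCoeff_succAbove] at this
    have hpos : 0 < |simplexDet y| := abs_pos.mpr hD
    nlinarith
  refine Fin.cases ?_ (fun k => ?_) l
  · have h0 := hb 0 j
    simp only [graphLift, Fin.insertNth_apply_same, zero_add, homog_dotProduct] at h0
    have hsum : |∑ k, y 0 k * c k.succ| ≤ m * R := by
      refine (Finset.abs_sum_le_sum_abs _ _).trans ?_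
      have : ∀ k ∈ Finset.univ, |y 0 k * c (Fin.succ k)| ≤ R := by
        intro k _
        have h1 := hb 0 (j.succAbove k)
        simp only [graphLift, Fin.insertNth_apply_succAbove] at h1
        rw [abs_mul]
        nlinarith [abs_nonneg (y 0 k), abs_nonneg (c k.succ), hsucc k]
      simpa using Finset.sum_le_sum this
    have := abs_sub_abs_le_abs_sub (c 0) (-∑ k, y 0 k * c k.succ)
    rw [sub_neg_eq_add, abs_neg] at this
    nlinarith
  · have := hsucc k
    nlinarith [mul_nonneg (show (0 : ℝ) ≤ m + 1 by positivity) hR]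

lemma one_sub_pow_le_exp (v : ℝ) (N : ℕ) :
    ENNReal.ofReal (1 - v) ^ N ≤ ENNReal.ofReal (Real.exp (-(v * N))) := by
  have h1 : ENNReal.ofReal (1 - v) ≤ ENNReal.ofReal (Real.exp (-v)) :=
    ENNReal.ofReal_le_ofReal (Real.one_sub_le_exp_neg v)
  refine (pow_le_pow_left' h1 N).trans ?_
  rw [← ENNReal.ofReal_pow (Real.exp_pos _).le, ← Real.exp_nat_mul]
  gcongr
  apply le_of_eq
  ring

theorem exists_natCast_mul_lintegral_emptyDensity_le {m : ℕ}
    {U : Set (Fin (m + 1) → ℝ)} (hU : MeasurableSet U) {R : ℝ} (hR : 0 ≤ R)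
    (hb : ∀ x ∈ U, ∀ k, |x k| ≤ R) :
    ∃ C : ℝ≥0∞, C ≠ ∞ ∧ ∀ N : ℕ, N ≠ 0 → N * ∫⁻ z, emptyDensity U N z ≤ C := by
  classical
  let L : ℝ := 1 + (m + 1) * R
  let BY : Set (Fin (m + 1) → Fin m → ℝ) := Set.pi Set.univ fun _ => Set.pi Set.univ fun _ =>
    Set.Icc (-R) R
  let BC : Set (Fin (m + 1) → ℝ) := Set.pi Set.univ fun _ => Set.Icc (-L) L
  let B0 : Set (Fin m → ℝ) := Set.pi Set.univ fun _ => Set.Icc (-R) R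
  have hB0 : MeasurableSet B0 := MeasurableSet.univ_pi fun _ => measurableSet_Icc
  have hBC : MeasurableSet BC := MeasurableSet.univ_pi fun _ => measurableSet_Icc
  have hBY : MeasurableSet BY := MeasurableSet.univ_pi fun _ => hB0
  have hv0 : volume B0 ≠ ∞ :=
    (isCompact_univ_pi fun _ => isCompact_Icc).measure_lt_top.ne
  have hvC : volume BC ≠ ∞ :=
    (isCompact_univ_pi fun _ => isCompact_Icc).measure_lt_top.ne
  have hvY : volume BY ≠ ∞ :=
    (isCompact_univ_pi fun _ => isCompact_univ_pi fun _ => isCompact_Icc).measure_lt_top.ne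
  let C₁ : ℝ≥0∞ := ENNReal.ofReal (2 * (m + 1).factorial) * volume B0 * volume BC * volume BY
  have hC₁ : C₁ ≠ ∞ := by
    refine ENNReal.mul_ne_top (ENNReal.mul_ne_top (ENNReal.mul_ne_top ?_ hv0) hvC) hvY
    exact ENNReal.ofReal_ne_top
  refine ⟨(m + 1 : ℕ) * C₁, ENNReal.mul_ne_top (by simp) hC₁, fun N hN => ?_⟩
  have hE := measurable_emptyDensity hU N
  have htail : Measurable fun z : Fin (m + 2) → Fin (m + 1) → ℝ => Fin.tail z :=
    measurable_pi_lambda _ fun i => measurable_pi_apply i.succ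
  let F : Fin (m + 1) → (Fin (m + 2) → Fin (m + 1) → ℝ) → ℝ≥0∞ := fun j =>
    (Fin.tail ⁻¹' dominatedBy j).indicator (emptyDensity U N)
  have hF : ∀ j, Measurable (F j) := fun j =>
    hE.indicator (htail (isClosed_dominatedBy j).measurableSet)
  have hle : ∀ z, emptyDensity U N z ≤ ∑ j, F j z := by
    intro z
    obtain ⟨j, hj⟩ := exists_mem_dominatedBy (Fin.tail z)
    have : emptyDensity U N z = F j z := by
      simp only [F]
      rw [Set.indicator_of_mem (by exact hj)]
    rw [this]
    exact Finset.single_le_sum (f := fun j => F j z) (fun _ _ => zero_le) (Finset.mem_univ j)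
  have hmain : ∀ j, N * ∫⁻ z, F j z ≤ C₁ := by
    intro j
    rw [lintegral_cons_eq_lintegral_graphLift j (ae_simplexDet_ne_zero m) (hF j),
      ← lintegral_const_mul' _ _ (by simp)]
    have hpt : ∀ y : Fin (m + 1) → Fin m → ℝ, simplexDet y ≠ 0 → ∀ c y₀ s,
        F j (Fin.cons (graphLift j c s y₀) fun i => graphLift j c 0 (y i)) ≤
        BY.indicator 1 y * (BC.indicator 1 c * (B0.indicator 1 y₀ *
          ENNReal.ofReal (Real.exp (-(|simplexDet y| / (m + 1).factorial * N * |s|))))) := by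
      intro y hy c y₀ s
      simp only [F]
      by_cases hdom : (fun i => graphLift j c 0 (y i)) ∈ dominatedBy j
      swap
      · rw [Set.indicator_of_notMem (by simpa [Fin.tail_cons] using hdom)]
        exact zero_le
      rw [Set.indicator_of_mem (by simpa [Fin.tail_cons] using hdom), emptyDensity_cons_graphLift]
      by_cases hs : graphLift j c s y₀ ∈ U ∧ ∀ i, y i ∈ graphSection j U c
      swap
      · rw [Set.indicator_of_notMem (by exact hs)]
        exact zero_le
      rw [Set.indicator_of_mem (by exact hs)]
      have hy0 : y₀ ∈ B0 := by
        intro k _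
        have := hb _ hs.1 (j.succAbove k)
        simpa [graphLift, abs_le] using this
      have hyB : y ∈ BY := by
        intro i _ k _
        have := hb _ (hs.2 i) (j.succAbove k)
        simpa [graphLift, abs_le] using this
      have hcB : c ∈ BC := by
        intro l _
        exact abs_le.mp (abs_coeff_le_of_mem_dominatedBy hR hy hdom
          (fun i k => hb _ (hs.2 i) k) l)
      rw [Set.indicator_of_mem hy0, Set.indicator_of_mem hyB, Set.indicator_of_mem hcB]
      simp only [Pi.one_apply, one_mul]
      refine (one_sub_pow_le_exp _ N).trans (le_of_eq ?_)
      congr 3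
      ring
    calc ∫⁻ y : Fin (m + 1) → Fin m → ℝ, N * (ENNReal.ofReal |simplexDet y| * ∫⁻ c, ∫⁻ y₀, ∫⁻ s,
          F j (Fin.cons (graphLift j c s y₀) fun i => graphLift j c 0 (y i)))
        ≤ ∫⁻ y : Fin (m + 1) → Fin m → ℝ, BY.indicator 1 y *
            (ENNReal.ofReal (2 * (m + 1).factorial) * volume B0 * volume BC) := by
          refine lintegral_mono_ae ?_
          filter_upwards [ae_simplexDet_ne_zero m] with y hy
          have hpos : 0 < |simplexDet y| := abs_pos.mpr hy
          have hNpos : (0 : ℝ) < N := by positivity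
          have hBYtop : BY.indicator (1 : (Fin (m + 1) → Fin m → ℝ) → ℝ≥0∞) y ≠ ∞ := by
            rw [Set.indicator_apply]; split_ifs <;> simp
          have hBCtop : ∀ c, BC.indicator (1 : (Fin (m + 1) → ℝ) → ℝ≥0∞) c ≠ ∞ := by
            intro c; rw [Set.indicator_apply]; split_ifs <;> simp
          have hB0top : ∀ y₀, B0.indicator (1 : (Fin m → ℝ) → ℝ≥0∞) y₀ ≠ ∞ := by
            intro c; rw [Set.indicator_apply]; split_ifs <;> simp
          have hle2 : ∫⁻ c, ∫⁻ y₀, ∫⁻ s,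
              F j (Fin.cons (graphLift j c s y₀) fun i => graphLift j c 0 (y i)) ≤
              ∫⁻ c, ∫⁻ y₀, ∫⁻ s, BY.indicator 1 y * (BC.indicator 1 c * (B0.indicator 1 y₀ *
                ENNReal.ofReal (Real.exp
                  (-(|simplexDet y| / (m + 1).factorial * N * |s|))))) :=
            lintegral_mono fun c => lintegral_mono fun y₀ => lintegral_mono fun s =>
              hpt y hy c y₀ s
          have heq : ∫⁻ c, ∫⁻ y₀, ∫⁻ s, BY.indicator 1 y * (BC.indicator 1 c *
              (B0.indicator 1 y₀ * ENNReal.ofReal (Real.exp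
                  (-(|simplexDet y| / (m + 1).factorial * N * |s|))))) =
              BY.indicator 1 y * (volume BC * (volume B0 *
                ENNReal.ofReal (2 / (|simplexDet y| / (m + 1).factorial * N)))) := by
            have hin := lintegral_exp_neg_mul_abs
              (show 0 < |simplexDet y| / (m + 1).factorial * N by positivity)
            simp_rw [lintegral_const_mul' _ _ hBYtop, lintegral_const_mul' _ _ (hBCtop _),
              lintegral_const_mul' _ _ (hB0top _), hin]
            rw [lintegral_mul_const' _ _ ENNReal.ofReal_ne_top, lintegral_indicator_one hB0,
              lintegral_mul_const' _ _ (ENNReal.mul_ne_top hv0 ENNReal.ofReal_ne_top),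
              lintegral_indicator_one hBC]
          refine (mul_le_mul_right (mul_le_mul_right (hle2.trans heq.le) _) _).trans ?_
          have hfin : (N : ℝ≥0∞) * ENNReal.ofReal |simplexDet y| *
              ENNReal.ofReal (2 / (|simplexDet y| / (m + 1).factorial * N)) =
              ENNReal.ofReal (2 * (m + 1).factorial) := by
            rw [← ENNReal.ofReal_natCast, ← ENNReal.ofReal_mul hNpos.le,
              ← ENNReal.ofReal_mul (by positivity)]
            congr 1
            field_simp
          rw [← hfin]
          apply le_of_eq
          ring
      _ = C₁ := by
          rw [lintegral_mul_const' _ _ (ENNReal.mul_ne_top (ENNReal.mul_ne_top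
            ENNReal.ofReal_ne_top hv0) hvC), lintegral_indicator_one hBY, mul_comm]
  calc N * ∫⁻ z, emptyDensity U N z ≤ N * ∫⁻ z, ∑ j, F j z := by
        gcongr with z
        exact hle z
    _ = ∑ j, N * ∫⁻ z, F j z := by
        rw [lintegral_finsetSum _ fun j _ => hF j, Finset.mul_sum]
    _ ≤ ∑ _j : Fin (m + 1), C₁ := Finset.sum_le_sum fun j _ => hmain j
    _ = (m + 1 : ℕ) * C₁ := by simp

lemma convexHull_range_eq_image_stdSimplex {ι E : Type*} [Fintype ι] [AddCommGroup E] [Module ℝ E]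
    (z : ι → E) :
    convexHull ℝ (Set.range z) = (fun w : ι → ℝ => ∑ i, w i • z i) '' stdSimplex ℝ ι := by
  classical
  have h := (Fintype.linearCombination ℝ z).image_convexHull
    (Set.range fun i : ι => (Pi.single i 1 : ι → ℝ))
  rw [convexHull_rangle_single_eq_stdSimplex, ← Set.range_comp] at h
  have hz : (Fintype.linearCombination ℝ z) ∘ (fun i : ι => (Pi.single i 1 : ι → ℝ)) = z := by
    ext i
    simp [Fintype.linearCombination_apply, Pi.single_apply]
  rw [hz] at h
  rw [← h]
  rfl

lemma mem_convexHull_range_iff {ι E : Type*} [Fintype ι] [AddCommGroup E] [Module ℝ E]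
    {z : ι → E} {p : E} :
    p ∈ convexHull ℝ (Set.range z) ↔
      ∃ w : ι → ℝ, (∀ i, 0 ≤ w i) ∧ ∑ i, w i = 1 ∧ ∑ i, w i • z i = p := by
  rw [convexHull_range_eq_image_stdSimplex]
  simp [stdSimplex, and_assoc]

/-- The simplex of points with nonnegative coordinates of sum at most `r`. -/
def cornerSimplex (k : ℕ) (r : ℝ) : Set (Fin k → ℝ) :=
  {w | (∀ i, 0 ≤ w i) ∧ ∑ i, w i ≤ r}

lemma isClosed_cornerSimplex (k : ℕ) (r : ℝ) : IsClosed (cornerSimplex k r) := by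
  have : cornerSimplex k r = (⋂ i, {w | 0 ≤ w i}) ∩ {w | ∑ i, w i ≤ r} := by
    ext; simp [cornerSimplex]
  rw [this]
  exact (isClosed_iInter fun i => isClosed_le continuous_const (continuous_apply i)).inter
    (isClosed_le (by fun_prop) continuous_const)

lemma volume_cornerSimplex (k : ℕ) : ∀ {r : ℝ}, 0 ≤ r →
    volume (cornerSimplex k r) = ENNReal.ofReal (r ^ k / k.factorial) := by
  induction k with
  | zero =>
    intro r hr
    have : cornerSimplex 0 r = Set.univ := by
      ext; simp [cornerSimplex, hr]
    rw [this]
    simp [volume_pi]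
  | succ k ih =>
    intro r hr
    have e := (volume_preserving_piFinSuccAbove (fun _ : Fin (k + 1) => ℝ) 0).symm
    rw [← e.measure_preimage_equiv, Measure.volume_eq_prod,
      Measure.prod_apply (e.measurable (isClosed_cornerSimplex _ _).measurableSet)]
    have hsec : ∀ t : ℝ, volume (Prod.mk t ⁻¹'
        ((MeasurableEquiv.piFinSuccAbove (fun _ : Fin (k + 1) => ℝ) 0).symm ⁻¹'
          cornerSimplex (k + 1) r)) =
        (Set.Ioc 0 r).indicator (fun t => ENNReal.ofReal ((r - t) ^ k / k.factorial)) t ∨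
        t = 0 := by
      intro t
      by_cases h0 : t = 0
      · right; exact h0
      left
      by_cases ht : t ∈ Set.Ioc 0 r
      · rw [Set.indicator_of_mem ht, ← ih (sub_nonneg.mpr ht.2)]
        congr 1
        ext y
        simp [cornerSimplex, MeasurableEquiv.piFinSuccAbove_symm_apply, Fin.forall_fin_succ,
          Fin.sum_univ_succ, ht.1.le, Fin.insertNthEquiv, le_sub_iff_add_le, add_comm]
      · rw [Set.indicator_of_notMem ht]
        convert! measure_empty (μ := (volume : Measure (Fin k → ℝ)))
        ext y
        simp only [Set.mem_preimage, cornerSimplex, MeasurableEquiv.piFinSuccAbove_symm_apply,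
          Set.mem_ofPred_eq, Set.mem_empty_iff_false, iff_false, Fin.insertNthEquiv,
          Fin.forall_fin_succ, Fin.sum_univ_succ]
        simp only [Equiv.coe_fn_mk, Fin.insertNth_zero', Fin.cons_zero, Fin.cons_succ]
        rintro ⟨⟨h1, h2⟩, h3⟩
        refine ht ⟨lt_of_le_of_ne h1 (Ne.symm h0), ?_⟩
        have := Finset.sum_nonneg fun i (_ : i ∈ Finset.univ) => h2 i
        linarith
    have hae : ∀ᵐ t : ℝ, volume (Prod.mk t ⁻¹'
        ((MeasurableEquiv.piFinSuccAbove (fun _ : Fin (k + 1) => ℝ) 0).symm ⁻¹'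
          cornerSimplex (k + 1) r)) =
        (Set.Ioc 0 r).indicator (fun t => ENNReal.ofReal ((r - t) ^ k / k.factorial)) t := by
      filter_upwards [Measure.ae_ne volume (0 : ℝ)] with t ht
      exact (hsec t).resolve_right ht
    rw [lintegral_congr_ae hae, lintegral_indicator measurableSet_Ioc,
      ← ofReal_integral_eq_lintegral_ofReal]
    · congr 1
      rw [← intervalIntegral.integral_of_le hr, intervalIntegral.integral_div,
        intervalIntegral.integral_comp_sub_left (fun t => t ^ k) r]
      simp only [sub_self, sub_zero, integral_pow, ne_eq, Nat.add_eq_zero_iff, one_ne_zero,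
        and_false, not_false_eq_true, zero_pow, Nat.factorial_succ, Nat.cast_mul, Nat.cast_add,
        Nat.cast_one]
      field_simp
    · have : Continuous fun t : ℝ => (r - t) ^ k / (k.factorial : ℝ) := by fun_prop
      exact (this.integrableOn_Icc).mono_set Set.Ioc_subset_Icc_self
    · filter_upwards [ae_restrict_mem measurableSet_Ioc] with t ht
      have : 0 ≤ r - t := sub_nonneg.mpr ht.2
      positivity

lemma simplexDet_eq_det_sub {k : ℕ} (z : Fin (k + 1) → Fin k → ℝ) :
    simplexDet z = (Matrix.of fun i : Fin k => z i.succ - z 0).det := by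
  let B : Matrix (Fin (k + 1)) (Fin (k + 1)) ℝ :=
    Fin.cons (homog (z 0)) fun i => Fin.cons 0 (z i.succ - z 0)
  have h1 : simplexDet z = B.det := by
    refine Matrix.det_eq_of_forall_row_eq_smul_add_const (Fin.cons 0 fun _ => 1) 0 (by simp) ?_
    intro i j
    refine Fin.cases ?_ (fun i => ?_) i
    · simp [B]
    · refine Fin.cases ?_ (fun j => ?_) j <;> simp [B, homog]
  rw [h1, Matrix.det_succ_column_zero, Fin.sum_univ_succ]
  have h2 : B.submatrix (Fin.succAbove 0) Fin.succ = Matrix.of fun i : Fin k => z i.succ - z 0 := by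
    ext i j
    rfl
  rw [h2]
  simp [B, homog]

theorem volume_convexHull_range {k : ℕ} (z : Fin (k + 1) → Fin k → ℝ) :
    volume (convexHull ℝ (Set.range z)) = ENNReal.ofReal (|simplexDet z| / k.factorial) := by
  let v : Matrix (Fin k) (Fin k) ℝ := Matrix.of fun i : Fin k => z i.succ - z 0
  have himg : convexHull ℝ (Set.range z) =
      (fun x => z 0 + x) '' (Matrix.toLin' v.transpose '' cornerSimplex k 1) := by
    ext p
    rw [mem_convexHull_range_iff, Set.image_image]
    have hlin : ∀ w : Fin k → ℝ, Matrix.toLin' v.transpose w =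
        ∑ i, w i • z i.succ - (∑ i, w i) • z 0 := by
      intro w
      ext l
      simp [v, Matrix.mulVec, dotProduct, Finset.sum_mul, mul_comm, mul_sub]
    constructor
    · rintro ⟨w, hw0, hw1, rfl⟩
      refine ⟨fun i => w i.succ, ⟨fun i => hw0 _, ?_⟩, ?_⟩
      · rw [Fin.sum_univ_succ] at hw1
        linarith [hw0 0]
      · rw [Fin.sum_univ_succ] at hw1 ⊢
        have : w 0 = 1 - ∑ i : Fin k, w i.succ := by linarith
        simp only [hlin, this]
        module
    · rintro ⟨w, ⟨hw0, hw1⟩, rfl⟩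
      refine ⟨Fin.cons (1 - ∑ i, w i) w, ?_, ?_, ?_⟩
      · intro i
        refine Fin.cases ?_ (fun i => ?_) i
        · simpa using hw1
        · simpa using hw0 i
      · simp [Fin.sum_univ_succ]
      · simp only [Fin.sum_univ_succ, Fin.cons_zero, Fin.cons_succ, hlin]
        module
  rw [himg, Set.image_add_left, measure_preimage_add, Measure.addHaar_image_linearMap,
    LinearMap.det_toLin', Matrix.det_transpose, volume_cornerSimplex k zero_le_one,
    ← ENNReal.ofReal_mul (abs_nonneg _), simplexDet_eq_det_sub]
  simp [v, div_eq_mul_inv]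

lemma measurePreserving_pi_split {ι κ γ E : Type*} [Fintype ι] [Fintype κ] [Fintype γ]
    [MeasurableSpace E] (ν : Measure E) [SigmaFinite ν] (σ : ι ⊕ κ ≃ γ) :
    MeasurePreserving
      (fun x : γ → E => ((fun i => x (σ (.inl i)), fun i => x (σ (.inr i))) : (ι → E) × (κ → E)))
      (Measure.pi fun _ => ν) ((Measure.pi fun _ => ν).prod (Measure.pi fun _ => ν)) :=
  (measurePreserving_sumPiEquivProdPi fun _ : ι ⊕ κ => ν).comp
    (measurePreserving_piCongrLeft (fun _ : γ => ν) σ).symm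

lemma ae_pi_comp_of_injective {ι γ E : Type*} [Fintype ι] [Fintype γ]
    [MeasurableSpace E] (ν : Measure E) [SigmaFinite ν] {e : ι → γ} (he : Function.Injective e)
    {p : (ι → E) → Prop} (hp : ∀ᵐ y ∂(Measure.pi fun _ : ι => ν), p y) :
    ∀ᵐ x ∂(Measure.pi fun _ : γ => ν), p (fun i => x (e i)) := by
  classical
  let σ : ι ⊕ ↥(Set.range e)ᶜ ≃ γ :=
    ((Equiv.ofInjective e he).sumCongr (Equiv.refl _)).trans (Equiv.Set.sumCompl (Set.range e))
  have h := (measurePreserving_pi_split ν σ).quasiMeasurePreserving.ae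
    (Measure.quasiMeasurePreserving_fst.ae hp)
  filter_upwards [h] with x hx
  exact hx

lemma eq_zero_of_simplexDet_ne_zero {k : ℕ} {z : Fin (k + 1) → Fin k → ℝ} (hz : simplexDet z ≠ 0)
    {w : Fin (k + 1) → ℝ} (h0 : ∑ i, w i = 0) (h1 : ∑ i, w i • z i = 0) : w = 0 := by
  refine Matrix.eq_zero_of_vecMul_eq_zero hz ?_
  ext j
  refine Fin.cases ?_ (fun j => ?_) j
  · simpa [Matrix.vecMul, dotProduct, homog] using h0
  · simpa [Matrix.vecMul, dotProduct, homog] using congrFun h1 j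

lemma isClosed_setOf_mem_convexHull_range {ι E : Type*} [Fintype ι] [NormedAddCommGroup E]
    [NormedSpace ℝ E] :
    IsClosed {q : (ι → E) × E | q.2 ∈ convexHull ℝ (Set.range q.1)} := by
  have : CompactSpace (stdSimplex ℝ ι) := isCompact_iff_compactSpace.mp (isCompact_stdSimplex ℝ ι)
  have hcl : IsClosed {q : stdSimplex ℝ ι × ((ι → E) × E) |
      ∑ i, (q.1 : ι → ℝ) i • q.2.1 i = q.2.2} := by
    refine isClosed_eq ?_ (by fun_prop)
    refine continuous_finsetSum _ fun i _ => Continuous.smul ?_ (by fun_prop)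
    exact (continuous_apply i).comp (continuous_subtype_val.comp continuous_fst)
  convert! isClosedMap_snd_of_compactSpace _ hcl using 1
  ext q
  rw [Set.mem_ofPred_eq, convexHull_range_eq_image_stdSimplex]
  constructor
  · rintro ⟨w, hw, h⟩
    exact ⟨(⟨w, hw⟩, q), h, rfl⟩
  · rintro ⟨⟨w, q'⟩, h, rfl⟩
    exact ⟨w, w.2, h⟩

lemma image_setOf_ne_eq_range {n : ℕ} {E : Type*} (x : Fin (n + 1) → E) (i : Fin (n + 1)) :
    x '' {j | j ≠ i} = Set.range fun k => x (i.succAbove k) := by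
  have : {j | j ≠ i} = Set.range i.succAbove := by
    rw [Fin.range_succAbove]; rfl
  rw [this, ← Set.range_comp]
  rfl

lemma pi_smul_restrict {ι E : Type*} [Fintype ι] [MeasureSpace E]
    [SigmaFinite (volume : Measure E)] (A : Set E) {c : ℝ≥0∞} (hc : c ≠ ∞) :
    Measure.pi (fun _ : ι => c • (volume : Measure E).restrict A) =
      c ^ Fintype.card ι • (volume : Measure (ι → E)).restrict (Set.univ.pi fun _ => A) := by
  have : SigmaFinite (c • (volume : Measure E).restrict A) := by
    lift c to NNReal using hc
    exact SMul.sigmaFinite c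
  refine Measure.pi_eq fun s _ => ?_
  rw [volume_pi, Measure.restrict_pi_pi]
  simp [Measure.pi_pi, Finset.prod_mul_distrib]

/-- If two of `m + 2` points in general position lie in the convex hull of the remaining ones,
then these two points coincide. -/
lemma eq_of_mem_convexHull_range_succAbove {m : ℕ} (hm : m ≠ 0)
    {x : Fin (m + 2) → Fin m → ℝ}
    (hx : ∀ i : Fin (m + 2), simplexDet (fun k => x (i.succAbove k)) ≠ 0)
    {a b : Fin (m + 2)} (ha : x a ∈ convexHull ℝ (Set.range fun k => x (a.succAbove k)))
    (hb : x b ∈ convexHull ℝ (Set.range fun k => x (b.succAbove k))) : a = b := by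
  by_contra hab
  have key : ∀ i, x i ∈ convexHull ℝ (Set.range fun k => x (i.succAbove k)) →
      ∃ w : Fin (m + 2) → ℝ, w i = -1 ∧ (∀ k, k ≠ i → 0 ≤ w k) ∧ ∑ k, w k = 0 ∧
        ∑ k, w k • x k = 0 := by
    intro i hi
    obtain ⟨w, hw0, hw1, hwx⟩ := mem_convexHull_range_iff.mp hi
    refine ⟨i.insertNth (-1) w, by simp, ?_, ?_, ?_⟩
    · intro k hk
      obtain ⟨l, rfl⟩ := Fin.exists_succAbove_eq hk
      simpa using hw0 l
    · simp [Fin.sum_univ_succAbove _ i, hw1]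
    · simp [Fin.sum_univ_succAbove _ i, hwx]
  have indep : ∀ (i : Fin (m + 2)) (w : Fin (m + 2) → ℝ), w i = 0 → ∑ k, w k = 0 →
      ∑ k, w k • x k = 0 → w = 0 := by
    intro i w hi h0 h1
    rw [Fin.sum_univ_succAbove _ i, hi, zero_add] at h0
    rw [Fin.sum_univ_succAbove _ i, hi, zero_smul, zero_add] at h1
    have := eq_zero_of_simplexDet_ne_zero (hx i) h0 h1
    ext k
    by_cases hk : k = i
    · rw [hk, hi]; rfl
    · obtain ⟨l, rfl⟩ := Fin.exists_succAbove_eq hk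
      exact congrFun this l
  obtain ⟨u, hua, hu0, hus, hux⟩ := key a ha
  obtain ⟨w, hwb, hw0, hws, hwx⟩ := key b hb
  obtain ⟨c, hca, hcb⟩ : ∃ c : Fin (m + 2), c ≠ a ∧ c ≠ b := by
    have : ∃ c ∈ (Finset.univ : Finset (Fin (m + 2))), c ∉ ({a, b} : Finset (Fin (m + 2))) :=
      Finset.exists_mem_notMem_of_card_lt_card
        (Finset.card_le_two.trans_lt (by rw [Finset.card_univ, Fintype.card_fin]; omega))
    obtain ⟨c, -, hc⟩ := this
    exact ⟨c, by simpa using hc⟩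
  have hcomb := indep a (w a • u + w) (by simp [hua])
    (by simp [Finset.sum_add_distrib, ← Finset.mul_sum, hus, hws])
    (by simp [add_smul, Finset.sum_add_distrib, mul_smul, ← Finset.smul_sum, hux, hwx])
  have hc := congrFun hcomb c
  simp only [Pi.add_apply, Pi.smul_apply, smul_eq_mul, Pi.zero_apply] at hc
  have hwc : w c = 0 := by
    have := mul_nonneg (hw0 a hab) (hu0 c hca)
    linarith [hw0 c hcb]
  have := congrFun (indep c w hwc hws hwx) b
  rw [hwb] at this
  norm_num at this

lemma IsConvexBody.isProbabilityMeasure_unif {d : ℕ} {K : Set (Euc d)} (hK : IsConvexBody K) :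
    IsProbabilityMeasure (unif K) := by
  have h0 : volume K ≠ 0 := (Measure.measure_pos_of_nonempty_interior _ hK.2.2).ne'
  exact ⟨by simp [unif, ENNReal.inv_mul_cancel h0 hK.2.1.measure_lt_top.ne]⟩

lemma pSimplex_le_pMax {m : ℕ} {K : Set (Euc m)} (hK : IsConvexBody K) :
    pSimplex m K ≤ pMax m := by
  refine le_csSup ⟨1, ?_⟩ ⟨K, hK, rfl⟩
  rintro _ ⟨L, hL, rfl⟩
  have := hL.isProbabilityMeasure_unif
  exact measureReal_le_one

lemma volume_preimage_ofLp {d : ℕ} {A : Set (Fin d → ℝ)} (hA : MeasurableSet A) :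
    volume ((WithLp.ofLp : Euc d → Fin d → ℝ) ⁻¹' A) = volume A :=
  (PiLp.volume_preserving_ofLp (Fin d)).measure_preimage hA.nullMeasurableSet

lemma measurePreserving_ofLp_unif {d : ℕ} {A : Set (Fin d → ℝ)} (hA : MeasurableSet A) :
    MeasurePreserving (WithLp.ofLp : Euc d → Fin d → ℝ)
      (unif ((WithLp.ofLp : Euc d → Fin d → ℝ) ⁻¹' A)) ((volume A)⁻¹ • volume.restrict A) := by
  rw [unif, volume_preimage_ofLp hA]
  exact ((PiLp.volume_preserving_ofLp (Fin d)).restrict_preimage hA).smul_measure _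

lemma isConvexBody_preimage_ofLp {d : ℕ} {A : Set (Fin d → ℝ)} (hA : Convex ℝ A)
    (hc : IsCompact A) (hi : (interior A).Nonempty) :
    IsConvexBody ((WithLp.ofLp : Euc d → Fin d → ℝ) ⁻¹' A) := by
  let e := EuclideanSpace.equiv (Fin d) ℝ
  refine ⟨hA.linear_preimage e.toLinearMap, e.toHomeomorph.isCompact_preimage.mpr hc, ?_⟩
  have := e.toHomeomorph.preimage_interior A
  change (interior (e.toHomeomorph ⁻¹' A)).Nonempty
  rw [← this]
  exact hi.preimage e.surjective

lemma ofLp_mem_convexHull_range_iff {ι : Type*} {d : ℕ} (x : ι → Euc d) (p : Euc d) :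
    WithLp.ofLp p ∈ convexHull ℝ (Set.range fun i => WithLp.ofLp (x i)) ↔
      p ∈ convexHull ℝ (Set.range x) := by
  let e := EuclideanSpace.equiv (Fin d) ℝ
  have h : convexHull ℝ (Set.range fun i => WithLp.ofLp (x i)) =
      e '' convexHull ℝ (Set.range x) := by
    have := e.toLinearMap.image_convexHull (Set.range x)
    rw [← Set.range_comp] at this
    exact this.symm
  rw [h]
  exact e.injective.mem_set_image

theorem lintegral_simplexDet_le {m : ℕ} (hm : m ≠ 0) {V : Set (Fin m → ℝ)} (hV : Convex ℝ V)
    (hc : IsCompact V) (hi : (interior V).Nonempty) :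
    ((m + 2 : ℕ) : ℝ≥0∞) * ∫⁻ y in Set.univ.pi fun _ : Fin (m + 1) => V,
      ENNReal.ofReal (|simplexDet y| / m.factorial) ≤
        ENNReal.ofReal (pMax m) * volume V ^ (m + 2) := by
  have hVm : MeasurableSet V := hc.measurableSet
  have hv0 : volume V ≠ 0 := (Measure.measure_pos_of_nonempty_interior _ hi).ne'
  have hvt : volume V ≠ ∞ := hc.measure_lt_top.ne
  set v := volume V with hv
  have hci : v⁻¹ ≠ ∞ := ENNReal.inv_ne_top.mpr hv0
  let ν : Measure (Fin m → ℝ) := v⁻¹ • volume.restrict V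
  have hν : IsProbabilityMeasure ν :=
    ⟨by simp [ν, ← hv, ENNReal.inv_mul_cancel hv0 hvt]⟩
  let K : Set (Euc m) := (WithLp.ofLp : Euc m → Fin m → ℝ) ⁻¹' V
  have hK : IsConvexBody K := isConvexBody_preimage_ofLp hV hc hi
  have hmp : MeasurePreserving (WithLp.ofLp : Euc m → Fin m → ℝ) (unif K) ν :=
    measurePreserving_ofLp_unif hVm
  have hKp : IsProbabilityMeasure (unif K) := hK.isProbabilityMeasure_unif
  let S : Fin (m + 2) → Set (Fin (m + 2) → Fin m → ℝ) := fun i =>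
    {x | x i ∈ convexHull ℝ (Set.range fun k => x (i.succAbove k))}
  have hSm : ∀ i, MeasurableSet (S i) := fun i =>
    (isClosed_setOf_mem_convexHull_range.preimage
      (f := fun x : Fin (m + 2) → Fin m → ℝ => ((fun k => x (i.succAbove k)), x i))
      (by fun_prop)).measurableSet
  have hp : Measure.pi (fun _ : Fin (m + 2) => ν) (⋃ i, S i) ≤ ENNReal.ofReal (pMax m) := by
    refine le_trans (le_of_eq ?_) (ENNReal.ofReal_le_ofReal (pSimplex_le_pMax hK))
    rw [pSimplex, ENNReal.ofReal_toReal (measure_ne_top _ _),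
      ← (measurePreserving_pi (fun _ => unif K) (fun _ => ν) fun _ : Fin (m + 2) =>
        hmp).measure_preimage (MeasurableSet.iUnion hSm).nullMeasurableSet]
    congr 1
    ext x
    simp only [Set.preimage_iUnion, Set.mem_iUnion, Set.mem_preimage, S, Set.mem_ofPred_eq,
      image_setOf_ne_eq_range, ofLp_mem_convexHull_range_iff]
  have hae : ∀ᵐ x ∂(Measure.pi fun _ : Fin (m + 2) => ν), ∀ i : Fin (m + 2),
      simplexDet (fun k => x (i.succAbove k)) ≠ 0 := by
    refine ae_all_iff.mpr fun i => ae_pi_comp_of_injective ν Fin.succAbove_right_injective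
      (p := fun y => simplexDet y ≠ 0) ?_
    rw [pi_smul_restrict V hci]
    exact Measure.ae_smul_measure (ae_restrict_of_ae (ae_simplexDet_ne_zero m)) _
  have hdisj : Pairwise (Function.onFun (AEDisjoint (Measure.pi fun _ : Fin (m + 2) => ν)) S) := by
    intro a b hab
    refine measure_mono_null ?_ hae
    rintro x ⟨ha, hb⟩ hx
    exact hab (eq_of_mem_convexHull_range_succAbove hm hx ha hb)
  rw [measure_iUnion₀ hdisj fun i => (hSm i).nullMeasurableSet, tsum_fintype] at hp
  have hSi : ∀ i, Measure.pi (fun _ : Fin (m + 2) => ν) (S i) =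
      v⁻¹ ^ (m + 2) * ∫⁻ y in Set.univ.pi fun _ : Fin (m + 1) => V,
      ENNReal.ofReal (|simplexDet y| / m.factorial) := by
    intro i
    let T : Set ((Fin m → ℝ) × (Fin (m + 1) → Fin m → ℝ)) :=
      {q | q.1 ∈ convexHull ℝ (Set.range q.2)}
    have hT : MeasurableSet T := (isClosed_setOf_mem_convexHull_range.preimage
      (continuous_swap (X := Fin m → ℝ))).measurableSet
    have h := (measurePreserving_piFinSuccAbove (fun _ : Fin (m + 2) => ν) i).measure_preimage
      hT.nullMeasurableSet
    have hpre :
        (MeasurableEquiv.piFinSuccAbove (fun _ : Fin (m + 2) => Fin m → ℝ) i) ⁻¹' T = S i := by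
      ext x
      rfl
    rw [hpre] at h
    rw [h, Measure.prod_apply_symm hT, pi_smul_restrict V hci, lintegral_smul_measure,
      Fintype.card_fin, smul_eq_mul, pow_succ _ (m + 1), mul_assoc,
      ← lintegral_const_mul' v⁻¹ _ hci]
    congr 1
    refine setLIntegral_congr_fun (MeasurableSet.univ_pi fun _ => hVm) ?_
    intro y hy
    have hsub : convexHull ℝ (Set.range y) ⊆ V :=
      convexHull_min (Set.range_subset_iff.mpr fun k => hy k trivial) hV
    change (v⁻¹ • volume.restrict V) (convexHull ℝ (Set.range y)) = _
    rw [Measure.smul_apply, Measure.restrict_eq_self _ hsub, volume_convexHull_range, smul_eq_mul]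
  simp only [hSi, Finset.sum_const, Finset.card_univ, Fintype.card_fin, nsmul_eq_mul] at hp
  calc _ = (((m + 2 : ℕ) : ℝ≥0∞) * (v⁻¹ ^ (m + 2) * ∫⁻ y in Set.univ.pi fun _ : Fin (m + 1) => V,
      ENNReal.ofReal (|simplexDet y| / m.factorial))) * v ^ (m + 2) := by
        have : v⁻¹ ^ (m + 2) * v ^ (m + 2) = 1 := by
          rw [← mul_pow, ENNReal.inv_mul_cancel hv0 hvt, one_pow]
        rw [mul_assoc, mul_right_comm (v⁻¹ ^ (m + 2)), this, one_mul]
    _ ≤ _ := by gcongr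

theorem lintegral_simplexDet_le_of_isOpen {m : ℕ} (hm : m ≠ 0) {V : Set (Fin m → ℝ)}
    (hV : Convex ℝ V) (ho : IsOpen V) (hb : Bornology.IsBounded V) :
    ((m + 2 : ℕ) : ℝ≥0∞) * ∫⁻ y in Set.univ.pi fun _ : Fin (m + 1) => V,
      ENNReal.ofReal (|simplexDet y| / m.factorial) ≤
        ENNReal.ofReal (pMax m) * volume V ^ (m + 2) := by
  rcases V.eq_empty_or_nonempty with rfl | hne
  · have : (Set.univ.pi fun _ : Fin (m + 1) => (∅ : Set (Fin m → ℝ))) = ∅ :=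
      Set.univ_pi_eq_empty (i := 0) rfl
    simp [this]
  have hvol : volume (closure V) = volume V := by
    refine le_antisymm ?_ (measure_mono subset_closure)
    rw [closure_eq_self_union_frontier]
    exact (measure_union_le _ _).trans (by rw [hV.addHaar_frontier volume, add_zero])
  have h := lintegral_simplexDet_le hm hV.closure hb.isCompact_closure
    (hne.mono (interior_maximal subset_closure ho))
  rw [hvol] at h
  refine le_trans ?_ h
  gcongr
  exact subset_closure

lemma Convex.graphSection {m : ℕ} (j : Fin (m + 1)) {U : Set (Fin (m + 1) → ℝ)} (hU : Convex ℝ U)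
    (c : Fin (m + 1) → ℝ) : Convex ℝ (graphSection j U c) := by
  intro y hy y' hy' a b ha hb hab
  have h : graphLift j c 0 (a • y + b • y') =
      a • graphLift j c 0 y + b • graphLift j c 0 y' := by
    have hh : homog (a • y + b • y') = a • homog y + b • homog y' := by
      ext k
      refine Fin.cases ?_ (fun k => ?_) k <;> simp [homog, hab]
    ext k
    rcases Fin.eq_self_or_eq_succAbove j k with rfl | ⟨l, rfl⟩
    · simp [_root_.graphLift, hh]
    · simp [_root_.graphLift]
  change _root_.graphLift j c 0 (a • y + b • y') ∈ U
  rw [h]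
  exact hU hy hy' ha hb hab

lemma IsOpen.graphSection {m : ℕ} (j : Fin (m + 1)) {U : Set (Fin (m + 1) → ℝ)} (hU : IsOpen U)
    (c : Fin (m + 1) → ℝ) : IsOpen (graphSection j U c) :=
  hU.preimage (Continuous.graphLift j continuous_const continuous_const continuous_id)

lemma isBounded_graphSection {m : ℕ} (j : Fin (m + 1)) {U : Set (Fin (m + 1) → ℝ)}
    (hU : Bornology.IsBounded U) (c : Fin (m + 1) → ℝ) :
    Bornology.IsBounded (graphSection j U c) := by
  obtain ⟨R, hR⟩ := hU.exists_norm_le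
  refine isBounded_iff_forall_norm_le.mpr ⟨max R 0, fun y hy => ?_⟩
  refine (pi_norm_le_iff_of_nonneg (le_max_right _ _)).mpr fun k => ?_
  have := (norm_le_pi_norm (graphLift j c 0 y) (j.succAbove k)).trans (hR _ hy)
  simp only [graphLift, Fin.insertNth_apply_succAbove] at this
  exact this.trans (le_max_left _ _)

theorem volume_pow_le_lintegral_volume_graphSection {m : ℕ} (hm : m ≠ 0) (j : Fin (m + 1))
    {U : Set (Fin (m + 1) → ℝ)} (hU : Convex ℝ U) (ho : IsOpen U) (hb : Bornology.IsBounded U) :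
    ((m + 2 : ℕ) : ℝ≥0∞) * volume U ^ (m + 1) ≤ ENNReal.ofReal (m.factorial * pMax m) *
      ∫⁻ c : Fin (m + 1) → ℝ, volume (graphSection j U c) ^ (m + 2) := by
  classical
  have hUm := ho.measurableSet
  have hW := measurableSet_forall_graphSection j hUm
  have hΔ : Measurable fun y : Fin (m + 1) → Fin m → ℝ => ENNReal.ofReal |simplexDet y| := by
    fun_prop
  have hfac : (0 : ℝ) < m.factorial := by positivity
  have h1 : volume U ^ (m + 1) = ∫⁻ c : Fin (m + 1) → ℝ,
      ∫⁻ y in Set.univ.pi fun _ : Fin (m + 1) => graphSection j U c,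
        ENNReal.ofReal |simplexDet y| := by
    have hpi : MeasurableSet (Set.univ.pi fun _ : Fin (m + 1) => U) :=
      MeasurableSet.univ_pi fun _ => hUm
    calc volume U ^ (m + 1) = volume (Set.univ.pi fun _ : Fin (m + 1) => U) := by
          simp [volume_pi, Measure.pi_pi]
      _ = ∫⁻ x, (Set.univ.pi fun _ : Fin (m + 1) => U).indicator 1 x := by
          rw [lintegral_indicator_one hpi]
      _ = ∫⁻ y : Fin (m + 1) → Fin m → ℝ, ∫⁻ c : Fin (m + 1) → ℝ,
            ENNReal.ofReal |simplexDet y| *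
            {p : (Fin (m + 1) → Fin m → ℝ) × (Fin (m + 1) → ℝ) |
              ∀ i, p.1 i ∈ graphSection j U p.2}.indicator 1 (y, c) := by
          rw [lintegral_eq_lintegral_graphLift j (ae_simplexDet_ne_zero m)
            (measurable_one.indicator hpi)]
          refine lintegral_congr fun y => ?_
          rw [lintegral_const_mul' _ _ ENNReal.ofReal_ne_top]
          congr 1
          refine lintegral_congr fun c => ?_
          simp [Set.indicator_apply, graphSection]
      _ = _ := by
          rw [lintegral_lintegral_swap]
          · refine lintegral_congr fun c => ?_
            rw [← lintegral_indicator
              (MeasurableSet.univ_pi fun _ => measurableSet_graphSection j hUm c)]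
            refine lintegral_congr fun y => ?_
            simp [Set.indicator_apply]
          · exact ((hΔ.comp measurable_fst).mul (measurable_one.indicator hW)).aemeasurable
  have hmeas : Measurable fun c : Fin (m + 1) → ℝ => volume (graphSection j U c) ^ (m + 2) :=
    (measurable_measure_prodMk_right (measurableSet_graphSection_prod j hUm)).pow_const _
  rw [h1, ENNReal.ofReal_mul hfac.le, ← lintegral_const_mul' _ _ (ENNReal.natCast_ne_top _),
    ← lintegral_const_mul _ hmeas]
  refine lintegral_mono fun c => ?_
  calc _ = ENNReal.ofReal m.factorial * (((m + 2 : ℕ) : ℝ≥0∞) *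
        ∫⁻ y in Set.univ.pi fun _ : Fin (m + 1) => graphSection j U c,
          ENNReal.ofReal (|simplexDet y| / m.factorial)) := by
        rw [mul_left_comm, ← lintegral_const_mul' _ _ ENNReal.ofReal_ne_top]
        congr 1
        refine lintegral_congr fun y => ?_
        rw [← ENNReal.ofReal_mul hfac.le, mul_div_cancel₀ _ hfac.ne']
    _ ≤ _ := by
        rw [mul_assoc]
        gcongr _ * ?_
        exact lintegral_simplexDet_le_of_isOpen hm (hU.graphSection j c) (ho.graphSection j c)
          (isBounded_graphSection j hb c)

/-- Every `d + 1` of the points `x i` span a nondegenerate simplex. -/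
def IsGeneric {d n : ℕ} (x : Fin n → Euc d) : Prop :=
  ∀ e : Fin (d + 1) → Fin n, Function.Injective e →
    simplexDet (fun k => WithLp.ofLp (x (e k))) ≠ 0

lemma IsGeneric.eq_zero {d n : ℕ} {x : Fin n → Euc d} (hx : IsGeneric x) {e : Fin (d + 1) → Fin n}
    (he : Function.Injective e) {w : Fin (d + 1) → ℝ} (h0 : ∑ i, w i = 0)
    (h1 : ∑ i, w i • x (e i) = 0) : w = 0 := by
  refine eq_zero_of_simplexDet_ne_zero (hx e he) h0 ?_
  simpa using congrArg WithLp.ofLp h1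

lemma IsGeneric.affineIndependent {d n : ℕ} {x : Fin n → Euc d} (hx : IsGeneric x)
    {e : Fin (d + 1) → Fin n} (he : Function.Injective e) :
    AffineIndependent ℝ fun k => x (e k) := by
  rw [affineIndependent_iff_of_fintype]
  intro w h0 h1 i
  rw [Finset.weightedVSub_eq_linear_combination _ h0] at h1
  exact congrFun (hx.eq_zero he h0 h1) i

lemma IsGeneric.injective {d n : ℕ} (hd : 1 ≤ d) (hn : d + 1 ≤ n) {x : Fin n → Euc d}
    (hx : IsGeneric x) : Function.Injective x := by
  intro i j hij
  obtain ⟨H, hH, hcard⟩ := Finset.exists_superset_card_eq (s := {i, j}) (n := d + 1)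
    (Finset.card_le_two.trans (by omega)) (by simpa using hn)
  have hr := Finset.range_orderEmbOfFin H hcard
  have hi : i ∈ Set.range (H.orderEmbOfFin hcard) := by rw [hr]; exact hH (by simp)
  have hj : j ∈ Set.range (H.orderEmbOfFin hcard) := by rw [hr]; exact hH (by simp)
  obtain ⟨a, rfl⟩ := hi
  obtain ⟨b, rfl⟩ := hj
  have := (hx.affineIndependent (H.orderEmbOfFin hcard).injective).injective hij
  rw [this]

/-- A simplex spanned by generic points contains a further point only in its interior. -/
lemma IsGeneric.forall_notMem_interior_iff {d n : ℕ} (hd : 1 ≤ d) {x : Fin n → Euc d}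
    (hx : IsGeneric x) {e : Fin (d + 1) → Fin n} (he : Function.Injective e) :
    (∀ p, x p ∉ interior (convexHull ℝ (Set.range fun k => x (e k)))) ↔
      ∀ p ∉ Set.range e, x p ∉ convexHull ℝ (Set.range fun k => x (e k)) := by
  have hai := hx.affineIndependent he
  let b : AffineBasis (Fin (d + 1)) ℝ (Euc d) :=
    ⟨fun k => x (e k), hai, hai.affineSpan_eq_top_iff_card_eq_finrank_add_one.mpr (by simp)⟩
  have hb : (b : Fin (d + 1) → Euc d) = fun k => x (e k) := rfl
  rw [← hb, b.interior_convexHull, b.convexHull_eq_nonneg_coord]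
  constructor
  · intro h p hp hmem
    refine h p fun i => lt_of_le_of_ne (hmem i) fun h0 => ?_
    have hinj : Function.Injective (Function.update e i p) := by
      intro k l hkl
      by_cases hk : k = i <;> by_cases hl : l = i
      · rw [hk, hl]
      · subst hk
        rw [Function.update_self, Function.update_of_ne hl] at hkl
        exact absurd ⟨l, hkl.symm⟩ hp
      · subst hl
        rw [Function.update_self, Function.update_of_ne hk] at hkl
        exact absurd ⟨k, hkl⟩ hp
      · rw [Function.update_of_ne hl, Function.update_of_ne hk] at hkl
        exact he hkl
    have hs : ∑ k, b.coord k (x p) = 1 := b.sum_coord_apply_eq_one _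
    have hv : ∑ k, b.coord k (x p) • x (e k) = x p := b.linear_combination_coord_eq_self _
    rw [Fin.sum_univ_succAbove _ i, ← h0] at hs hv
    have := hx.eq_zero hinj (w := Function.update (fun k => b.coord k (x p)) i (-1)) ?_ ?_
    · have := congrFun this i
      simp at this
    · rw [Fin.sum_univ_succAbove _ i]
      simp only [Function.update_self, ne_eq, Fin.succAbove_ne, not_false_eq_true,
        Function.update_of_ne]
      linarith
    · rw [Fin.sum_univ_succAbove _ i]
      simp only [Function.update_self, ne_eq, Fin.succAbove_ne, not_false_eq_true,
        Function.update_of_ne]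
      rw [zero_smul, zero_add] at hv
      rw [hv]
      simp
  · intro h p hp
    by_cases hpe : p ∈ Set.range e
    · obtain ⟨k, rfl⟩ := hpe
      have : Nontrivial (Fin (d + 1)) := Fin.nontrivial_iff_two_le.mpr (by omega)
      obtain ⟨l, hl⟩ := exists_ne k
      have h1 := hp l
      have h2 : b.coord l (x (e k)) = 0 := b.coord_apply_ne hl
      exact h1.ne' h2
    · exact h p hpe fun i => (hp i).le

lemma IsGeneric.isHole_image_iff {d n : ℕ} (hd : 1 ≤ d) (hn : d + 1 ≤ n) {x : Fin n → Euc d}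
    (hx : IsGeneric x) (H : Finset (Fin n)) :
    IsHole (d + 1) (Finset.image x Finset.univ) (Finset.image x H) ↔
      H.card = d + 1 ∧ ∀ p ∉ H, x p ∉ convexHull ℝ (x '' H) := by
  have hinj := hx.injective hd hn
  rw [IsHole, Finset.card_image_of_injective _ hinj]
  have hsub : Finset.image x H ⊆ Finset.image x Finset.univ :=
    Finset.image_subset_image (Finset.subset_univ _)
  simp only [hsub, true_and, Finset.coe_image]
  refine and_congr_right fun hcard => ?_
  have hr := Finset.range_orderEmbOfFin H hcard
  have hxr : x '' H = Set.range fun k => x (H.orderEmbOfFin hcard k) := by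
    rw [← hr, ← Set.range_comp]; rfl
  have he := (H.orderEmbOfFin hcard).injective
  have hconv : InConvexPosition (x '' H) := by
    rw [hxr]
    rintro _ ⟨k, rfl⟩ hk
    refine (hx.affineIndependent he).notMem_affineSpan_sdiff k Set.univ
      (convexHull_subset_affineSpan _ (convexHull_mono ?_ hk))
    rintro _ ⟨⟨l, rfl⟩, hl⟩
    exact ⟨l, ⟨trivial, fun h => hl (by rw [Set.mem_singleton_iff.mp h]; rfl)⟩, rfl⟩
  have h := hx.forall_notMem_interior_iff hd he
  rw [← hxr, hr] at h
  simpa [hconv] using h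

lemma IsGeneric.holeCount_eq {d n : ℕ} (hd : 1 ≤ d) (hn : d + 1 ≤ n) {x : Fin n → Euc d}
    (hx : IsGeneric x) :
    (holeCount d (d + 1) n x : ℝ≥0∞) = ∑ H ∈ Finset.powersetCard (d + 1) Finset.univ,
      {x : Fin n → Euc d | ∀ p ∉ H, x p ∉ convexHull ℝ (x '' H)}.indicator 1 x := by
  classical
  have h : (Finset.image x Finset.univ).powerset.filter
      (fun H => IsHole (d + 1) (Finset.image x Finset.univ) H) =
      ((Finset.powersetCard (d + 1) Finset.univ).filter
        fun H : Finset (Fin n) => ∀ p ∉ H, x p ∉ convexHull ℝ (x '' H)).image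
          (Finset.image x) := by
    ext S
    simp only [Finset.mem_filter, Finset.mem_powerset, Finset.mem_image, Finset.mem_powersetCard,
      Finset.subset_univ, true_and, Finset.subset_image_iff]
    constructor
    · rintro ⟨⟨H, rfl⟩, hH⟩
      exact ⟨H, (hx.isHole_image_iff hd hn H).mp hH, rfl⟩
    · rintro ⟨H, hH, rfl⟩
      exact ⟨⟨H, rfl⟩, (hx.isHole_image_iff hd hn H).mpr hH⟩
  have hc : holeCount d (d + 1) n x = ((Finset.powersetCard (d + 1) Finset.univ).filter
        fun H : Finset (Fin n) => ∀ p ∉ H, x p ∉ convexHull ℝ (x '' H)).card := by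
    rw [← Finset.card_image_of_injective _ (Finset.image_injective (hx.injective hd hn)), ← h,
      holeCount]
  rw [hc, Finset.card_filter]
  push_cast
  simp [Set.indicator_apply]

lemma ae_isGeneric {d : ℕ} (n : ℕ) {A : Set (Fin d → ℝ)} (hA : MeasurableSet A)
    (hA1 : volume A = 1) :
    ∀ᵐ x ∂(Measure.pi fun _ : Fin n => unif ((WithLp.ofLp : Euc d → Fin d → ℝ) ⁻¹' A)),
      IsGeneric x := by
  have hmp := measurePreserving_ofLp_unif hA
  have hs : IsFiniteMeasure ((volume A)⁻¹ • volume.restrict A) :=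
    ⟨by simp [hA1]⟩
  have hs' : IsFiniteMeasure (unif ((WithLp.ofLp : Euc d → Fin d → ℝ) ⁻¹' A)) :=
    ⟨by simp [unif, volume_preimage_ofLp hA, hA1]⟩
  have h0 : ∀ᵐ z ∂(Measure.pi fun _ : Fin (d + 1) => (volume A)⁻¹ • volume.restrict A),
      simplexDet z ≠ 0 := by
    rw [pi_smul_restrict A (by simp [hA1])]
    exact Measure.ae_smul_measure (ae_restrict_of_ae (ae_simplexDet_ne_zero d)) _
  have h1 := (measurePreserving_pi _ _ fun _ : Fin (d + 1) => hmp).quasiMeasurePreserving.ae h0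
  have h2 : ∀ e : {e : Fin (d + 1) → Fin n // Function.Injective e},
      ∀ᵐ x ∂(Measure.pi fun _ : Fin n => unif ((WithLp.ofLp : Euc d → Fin d → ℝ) ⁻¹' A)),
        simplexDet (fun k => WithLp.ofLp (x (e.1 k))) ≠ 0 := fun e =>
    ae_pi_comp_of_injective _ e.2 (p := fun y => simplexDet (fun k => WithLp.ofLp (y k)) ≠ 0) h1
  filter_upwards [ae_all_iff.mpr h2] with x hx e he
  exact hx ⟨e, he⟩

lemma measurableSet_forall_notMem_convexHull {ι κ : Type*} [Fintype ι] [Fintype κ] {d : ℕ} :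
    MeasurableSet {q : (ι → Euc d) × (κ → Euc d) |
      ∀ i, q.2 i ∉ convexHull ℝ (Set.range q.1)} := by
  have : {q : (ι → Euc d) × (κ → Euc d) | ∀ i, q.2 i ∉ convexHull ℝ (Set.range q.1)} =
      ⋂ i, ((fun q : (ι → Euc d) × (κ → Euc d) => (q.1, q.2 i)) ⁻¹'
        {q : (ι → Euc d) × Euc d | q.2 ∈ convexHull ℝ (Set.range q.1)})ᶜ := by
    ext; simp
  rw [this]
  exact MeasurableSet.iInter fun i => ((isClosed_setOf_mem_convexHull_range.preimage
    (by fun_prop)).measurableSet).compl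

/-- An enumeration of `Fin n` starting with a given subset. -/
lemma exists_equiv_sum_compl {n k : ℕ} {H : Finset (Fin n)} (hH : H.card = k) :
    ∃ σ : Fin k ⊕ ↥Hᶜ ≃ Fin n, (Set.range fun i => σ (.inl i)) = H ∧
      ∀ i : ↥Hᶜ, σ (.inr i) = i := by
  classical
  let f : Fin k ⊕ ↥Hᶜ → Fin n := Sum.elim (H.orderEmbOfFin hH) Subtype.val
  have hf : Function.Bijective f := by
    constructor
    · refine (H.orderEmbOfFin hH).injective.sumElim Subtype.val_injective fun a b h => ?_
      have := Finset.mem_compl.mp b.2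
      rw [← h] at this
      exact this (Finset.orderEmbOfFin_mem H hH a)
    · intro p
      by_cases hp : p ∈ H
      · obtain ⟨a, ha⟩ : p ∈ Set.range (H.orderEmbOfFin hH) := by
          rw [Finset.range_orderEmbOfFin]; exact hp
        exact ⟨.inl a, ha⟩
      · exact ⟨.inr ⟨p, Finset.mem_compl.mpr hp⟩, rfl⟩
  exact ⟨Equiv.ofBijective f hf, Finset.range_orderEmbOfFin H hH, fun _ => rfl⟩

lemma setOf_forall_notMem_convexHull_eq_preimage {d n k : ℕ} {H : Finset (Fin n)}
    {σ : Fin k ⊕ ↥Hᶜ ≃ Fin n} (h1 : (Set.range fun i => σ (.inl i)) = H)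
    (h2 : ∀ i : ↥Hᶜ, σ (.inr i) = i) :
    {x : Fin n → Euc d | ∀ p ∉ H, x p ∉ convexHull ℝ (x '' H)} =
      (fun x : Fin n → Euc d => ((fun i => x (σ (.inl i)), fun i => x (σ (.inr i))) :
        (Fin k → Euc d) × (↥Hᶜ → Euc d))) ⁻¹'
      {q | ∀ i, q.2 i ∉ convexHull ℝ (Set.range q.1)} := by
  ext x
  have hr : x '' H = Set.range fun i => x (σ (.inl i)) := by
    rw [← h1, ← Set.range_comp]; rfl
  simp [hr, h2]

lemma pi_unif_setOf_forall_notMem_convexHull {d n : ℕ} {A : Set (Fin d → ℝ)} (hc : Convex ℝ A)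
    (hA : MeasurableSet A) (hA1 : volume A = 1) {H : Finset (Fin n)} (hH : H.card = d + 1) :
    MeasurableSet {x : Fin n → Euc d | ∀ p ∉ H, x p ∉ convexHull ℝ (x '' H)} ∧
    Measure.pi (fun _ : Fin n => unif ((WithLp.ofLp : Euc d → Fin d → ℝ) ⁻¹' A))
      {x | ∀ p ∉ H, x p ∉ convexHull ℝ (x '' H)} =
    ∫⁻ z, emptyDensity A (n - (d + 1)) z := by
  classical
  have hmp := measurePreserving_ofLp_unif hA
  set μ := unif ((WithLp.ofLp : Euc d → Fin d → ℝ) ⁻¹' A) with hμ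
  have hs : IsFiniteMeasure ((volume A)⁻¹ • volume.restrict A) := ⟨by simp [hA1]⟩
  have hs' : IsProbabilityMeasure μ := ⟨by simp [hμ, unif, volume_preimage_ofLp hA, hA1]⟩
  obtain ⟨σ, h1, h2⟩ := exists_equiv_sum_compl hH
  rw [setOf_forall_notMem_convexHull_eq_preimage h1 h2]
  have hσ := measurePreserving_pi_split μ σ
  have hm := measurableSet_forall_notMem_convexHull (ι := Fin (d + 1)) (κ := ↥Hᶜ) (d := d)
  refine ⟨hσ.measurable hm, ?_⟩
  rw [hσ.measure_preimage hm.nullMeasurableSet, Measure.prod_apply hm]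
  have hcard : Fintype.card ↥Hᶜ = n - (d + 1) := by
    simp [hH]
  have hind : emptyDensity A (n - (d + 1)) = (Set.univ.pi fun _ => A).indicator
      fun z => ENNReal.ofReal (1 - |simplexDet z| / d.factorial) ^ (n - (d + 1)) := by
    ext z
    simp [emptyDensity, Set.indicator_apply]
  have hg : Measurable fun z : Fin (d + 1) → Fin d → ℝ =>
      ENNReal.ofReal (1 - |simplexDet z| / d.factorial) ^ (n - (d + 1)) := by fun_prop
  have hpi : MeasurableSet (Set.univ.pi fun _ : Fin (d + 1) => A) :=
    MeasurableSet.univ_pi fun _ => hA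
  have hpre := measurePreserving_pi _ _ fun _ : Fin (d + 1) => hmp
  have hrestr : Measure.pi (fun _ : Fin (d + 1) => (volume A)⁻¹ • volume.restrict A) =
      volume.restrict (Set.univ.pi fun _ => A) := by
    rw [pi_smul_restrict A (by simp [hA1]), hA1]
    simp
  rw [hrestr] at hpre
  rw [hind, lintegral_indicator hpi, ← hpre.lintegral_comp hg]
  have haeA := hpre.quasiMeasurePreserving.ae (ae_restrict_mem hpi)
  refine lintegral_congr_ae ?_
  filter_upwards [haeA] with y hy
  have hsec : Prod.mk y ⁻¹' {q : (Fin (d + 1) → Euc d) × (↥Hᶜ → Euc d) |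
      ∀ i, q.2 i ∉ convexHull ℝ (Set.range q.1)} =
      Set.univ.pi fun _ => (convexHull ℝ (Set.range y))ᶜ := by
    ext; simp
  rw [hsec, Measure.pi_pi, Finset.prod_const, Finset.card_univ, hcard]
  congr 1
  have hcl : IsCompact (convexHull ℝ (Set.range y)) := (Set.finite_range y).isCompact_convexHull ℝ
  have hcl' : IsCompact (convexHull ℝ (Set.range fun i => WithLp.ofLp (y i))) :=
    (Set.finite_range _).isCompact_convexHull ℝ
  have hpc : convexHull ℝ (Set.range y) = (WithLp.ofLp : Euc d → Fin d → ℝ) ⁻¹'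
      convexHull ℝ (Set.range fun i => WithLp.ofLp (y i)) := by
    ext p
    exact (ofLp_mem_convexHull_range_iff y p).symm
  have hsub : convexHull ℝ (Set.range fun i => WithLp.ofLp (y i)) ⊆ A :=
    convexHull_min (Set.range_subset_iff.mpr fun k => hy k trivial) hc
  rw [prob_compl_eq_one_sub hcl.measurableSet, hpc,
    hmp.measure_preimage hcl'.measurableSet.nullMeasurableSet, Measure.smul_apply,
    Measure.restrict_eq_self _ hsub, volume_convexHull_range, hA1,
    ENNReal.ofReal_sub _ (by positivity)]
  simp

theorem EH_eq {d n : ℕ} (hd : 1 ≤ d) (hn : d + 1 ≤ n) {A : Set (Fin d → ℝ)} (hc : Convex ℝ A)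
    (hA : MeasurableSet A) (hA1 : volume A = 1) :
    EH d (d + 1) ((WithLp.ofLp : Euc d → Fin d → ℝ) ⁻¹' A) n =
      (n.choose (d + 1) * ∫⁻ z, emptyDensity A (n - (d + 1)) z).toReal := by
  classical
  have hgen : (fun x => (holeCount d (d + 1) n x : ℝ≥0∞)) =ᵐ[Measure.pi fun _ : Fin n =>
      unif ((WithLp.ofLp : Euc d → Fin d → ℝ) ⁻¹' A)]
      fun x => ∑ H ∈ Finset.powersetCard (d + 1) Finset.univ,
        {x : Fin n → Euc d | ∀ p ∉ H, x p ∉ convexHull ℝ (x '' H)}.indicator 1 x := by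
    filter_upwards [ae_isGeneric n hA hA1] with x hx
    exact hx.holeCount_eq hd hn
  have hmeas : ∀ H ∈ Finset.powersetCard (d + 1) (Finset.univ : Finset (Fin n)),
      MeasurableSet {x : Fin n → Euc d | ∀ p ∉ H, x p ∉ convexHull ℝ (x '' H)} := fun H hH =>
    (pi_unif_setOf_forall_notMem_convexHull hc hA hA1 (Finset.mem_powersetCard.mp hH).2).1
  have hmeas' : ∀ H ∈ Finset.powersetCard (d + 1) (Finset.univ : Finset (Fin n)),
      Measurable ({x : Fin n → Euc d | ∀ p ∉ H, x p ∉ convexHull ℝ (x '' H)}.indicator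
        (1 : (Fin n → Euc d) → ℝ≥0∞)) := fun H hH => measurable_one.indicator (hmeas H hH)
  have hreal : EH d (d + 1) ((WithLp.ofLp : Euc d → Fin d → ℝ) ⁻¹' A) n =
      ∫ x, ((holeCount d (d + 1) n x : ℝ≥0∞)).toReal ∂(Measure.pi fun _ : Fin n =>
      unif ((WithLp.ofLp : Euc d → Fin d → ℝ) ⁻¹' A)) := by
    simp [EH]
  rw [hreal, integral_toReal]
  · congr 1
    rw [lintegral_congr_ae hgen, lintegral_finsetSum _ hmeas']
    have : ∀ H ∈ Finset.powersetCard (d + 1) (Finset.univ : Finset (Fin n)),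
        ∫⁻ x, {x : Fin n → Euc d | ∀ p ∉ H, x p ∉ convexHull ℝ (x '' H)}.indicator 1 x
          ∂(Measure.pi fun _ : Fin n => unif ((WithLp.ofLp : Euc d → Fin d → ℝ) ⁻¹' A)) =
        ∫⁻ z, emptyDensity A (n - (d + 1)) z := fun H hH => by
      rw [lintegral_indicator_one (hmeas H hH),
        (pi_unif_setOf_forall_notMem_convexHull hc hA hA1 (Finset.mem_powersetCard.mp hH).2).2]
    rw [Finset.sum_congr rfl this]
    simp
  · exact (Finset.measurable_fun_sum _ hmeas').aemeasurable.congr hgen.symm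
  · exact Eventually.of_forall fun x => ENNReal.natCast_lt_top _

lemma tendsto_choose_div_mul_pow (d : ℕ) :
    Tendsto (fun N : ℕ => ((N + (d + 1)).choose (d + 1) : ℝ) /
      (N * ((N + (d + 1) : ℕ) : ℝ) ^ d)) atTop (𝓝 (1 / (d + 1).factorial)) := by
  have h0 : Tendsto (fun n : ℕ => (n : ℝ) * (1 / (n : ℝ))) atTop (𝓝 1) := by
    refine tendsto_const_nhds.congr' ?_
    filter_upwards [eventually_ne_atTop 0] with n hn
    have : (n : ℝ) ≠ 0 := by exact_mod_cast hn
    field_simp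
  have h1 := (ProbabilityTheory.tendsto_choose_mul_pow_atTop (d + 1) h0).comp
    (tendsto_add_atTop_nat (d + 1))
  have h2 : Tendsto (fun N : ℕ => 1 + ((d + 1 : ℕ) : ℝ) / (N : ℝ)) atTop (𝓝 (1 + 0)) :=
    tendsto_const_nhds.add (tendsto_const_div_atTop_nhds_zero_nat _)
  have h3 := h1.mul h2
  rw [one_pow, add_zero, mul_one] at h3
  refine h3.congr' ?_
  filter_upwards [eventually_ne_atTop 0] with N hN
  have hN' : (N : ℝ) ≠ 0 := by exact_mod_cast hN
  have hN'' : ((N + (d + 1) : ℕ) : ℝ) ≠ 0 := by positivity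
  simp only [Function.comp_apply]
  have : 1 + ((d + 1 : ℕ) : ℝ) / (N : ℝ) = ((N + (d + 1) : ℕ) : ℝ) / N := by
    rw [Nat.cast_add N (d + 1)]
    field_simp
  rw [this, one_div, inv_pow, pow_succ]
  field_simp

lemma lintegral_emptyDensity_interior {d : ℕ} {A : Set (Fin d → ℝ)} (hA : Convex ℝ A) (N : ℕ) :
    ∫⁻ z, emptyDensity A N z = ∫⁻ z, emptyDensity (interior A) N z := by
  classical
  have h : ∀ᵐ x : Fin d → ℝ, x ∉ frontier A :=
    measure_eq_zero_iff_ae_notMem.mp (hA.addHaar_frontier volume)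
  have h' : ∀ᵐ z : Fin (d + 1) → Fin d → ℝ, ∀ i, z i ∉ frontier A :=
    ae_all_iff.mpr fun i => (Measure.quasiMeasurePreserving_eval
      (fun _ : Fin (d + 1) => (volume : Measure (Fin d → ℝ))) i).ae h
  refine lintegral_congr_ae ?_
  filter_upwards [h'] with z hz
  have : (∀ i, z i ∈ A) ↔ ∀ i, z i ∈ interior A := by
    refine forall_congr' fun i => ⟨fun hi => ?_, fun hi => interior_subset hi⟩
    by_contra hn
    exact hz i ⟨subset_closure hi, hn⟩
  simp [emptyDensity, Set.indicator_apply, this]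

/-- A lower bound for the limit inferior of a product `r * J`, where `r` converges. -/
lemma le_liminf_mul_toReal {r : ℕ → ℝ} {J : ℕ → ℝ≥0∞} {C : ℝ≥0∞} {q L : ℝ} (hq : 0 < q)
    (hL : 0 < L) (hr : Tendsto r atTop (𝓝 (1 / q))) (hC : C ≠ ∞) (hJC : ∀ N, N ≠ 0 → J N ≤ C)
    (hJ : ENNReal.ofReal (q * L) ≤ liminf J atTop) :
    L ≤ liminf (fun N => r N * (J N).toReal) atTop := by
  have hq' : 0 < 1 / q := by positivity
  have hrpos : ∀ᶠ N in atTop, 0 < r N := hr.eventually_const_lt hq'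
  have hbdd : IsBoundedUnder (· ≤ ·) atTop fun N => r N * (J N).toReal := by
    refine isBoundedUnder_of_eventually_le (a := (1 / q + 1) * C.toReal) ?_
    filter_upwards [hr.eventually_lt_const (lt_add_one _), eventually_ne_atTop 0] with N h1 h2
    have := ENNReal.toReal_mono hC (hJC N h2)
    gcongr
  refine le_of_forall_lt_imp_le_of_dense fun a ha => ?_
  obtain ⟨t, hat, htL⟩ := exists_between (max_lt ha hL)
  obtain ⟨hat, ht0⟩ := max_lt_iff.mp hat
  refine le_liminf_of_le hbdd.isCoboundedUnder_ge ?_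
  have hlt : ENNReal.ofReal (q * t) < liminf J atTop :=
    lt_of_lt_of_le ((ENNReal.ofReal_lt_ofReal_iff (by positivity)).mpr (by gcongr)) hJ
  have hlim : Tendsto (fun N => r N * (q * t)) atTop (𝓝 t) := by
    have := hr.mul_const (q * t)
    rwa [show 1 / q * (q * t) = t by field_simp] at this
  filter_upwards [hrpos, eventually_lt_of_lt_liminf hlt, hlim.eventually_const_lt hat,
    eventually_ne_atTop 0] with N h1 h2 h3 h4
  have hfin : J N ≠ ∞ := ne_top_of_le_ne_top hC (hJC N h4)
  have h5 : q * t ≤ (J N).toReal := (ENNReal.ofReal_le_iff_le_toReal hfin).mp h2.le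
  exact h3.le.trans (by gcongr)

/-- For every integer `d ≥ 2` and every convex body `K ⊆ ℝ^d` of unit volume,
`liminf_{n → ∞} n^{-d} · EH^K_{d,d+1}(n) ≥ 2 / ((d-1)! · p_{d-1})`. -/
theorem statement1 (d : ℕ) (hd : 2 ≤ d) (K : Set (Euc d))
    (hK : IsConvexBody K) (hvol : volume K = 1) :
    2 / ((Nat.factorial (d - 1) : ℝ) * pMax (d - 1)) ≤
      Filter.liminf (fun n : ℕ => EH d (d + 1) K n / (n : ℝ) ^ d) Filter.atTop := by
  obtain ⟨m, rfl⟩ : ∃ m, d = m + 1 := ⟨d - 1, by omega⟩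
  have hm : m ≠ 0 := by omega
  rw [Nat.add_sub_cancel]
  obtain ⟨hconv, hcomp, -⟩ := hK
  let e := EuclideanSpace.equiv (Fin (m + 1)) ℝ
  let A : Set (Fin (m + 1) → ℝ) := e.symm ⁻¹' K
  have hAK : (WithLp.ofLp : Euc (m + 1) → Fin (m + 1) → ℝ) ⁻¹' A = K := by
    ext p
    rfl
  have hA : Convex ℝ A := hconv.linear_preimage e.symm.toLinearMap
  have hAc : IsCompact A := e.symm.toHomeomorph.isCompact_preimage.mpr hcomp
  have hAm : MeasurableSet A := hAc.measurableSet
  have hA1 : volume A = 1 := by rw [← volume_preimage_ofLp hAm, hAK, hvol]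
  have hU1 : volume (interior A) = 1 := by
    rw [measure_congr (interior_ae_eq_of_null_frontier (hA.addHaar_frontier volume)), hA1]
  have hUb : Bornology.IsBounded (interior A) := hAc.isBounded.subset interior_subset
  have hsyl := volume_pow_le_lintegral_volume_graphSection hm 0 hA.interior isOpen_interior hUb
  rw [hU1, one_pow, mul_one] at hsyl
  have hpos : 0 < (m.factorial : ℝ) * pMax m := by
    by_contra h
    rw [ENNReal.ofReal_of_nonpos (not_lt.mp h), zero_mul] at hsyl
    simp at hsyl
  obtain ⟨R, hR⟩ := hUb.exists_norm_le
  obtain ⟨C, hC, hJC⟩ := exists_natCast_mul_lintegral_emptyDensity_le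
    isOpen_interior.measurableSet (le_max_right R 0)
    (fun x hx k => ((norm_le_pi_norm x k).trans (hR x hx)).trans (le_max_left R 0))
  have hJ : ENNReal.ofReal ((m + 2).factorial * (2 / ((m.factorial : ℝ) * pMax m))) ≤
      liminf (fun N : ℕ => (N : ℝ≥0∞) * ∫⁻ z, emptyDensity (interior A) N z) atTop := by
    refine le_trans ?_ (le_liminf_natCast_mul_lintegral_emptyDensity 0 isOpen_interior)
    have h1 : ((m + 2).factorial : ℝ) * (2 / ((m.factorial : ℝ) * pMax m)) =
        2 * (m + 1).factorial * ((m + 2 : ℕ) / ((m.factorial : ℝ) * pMax m)) := by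
      rw [Nat.factorial_succ (m + 1)]
      push_cast
      ring
    rw [h1, ENNReal.ofReal_mul (by positivity), ENNReal.ofReal_div_of_pos hpos,
      ENNReal.ofReal_natCast]
    gcongr
    exact ENNReal.div_le_of_le_mul' hsyl
  have hlim := le_liminf_mul_toReal (by positivity) (by positivity)
    (tendsto_choose_div_mul_pow (m + 1)) hC hJC hJ
  rw [← liminf_nat_add _ (m + 1 + 1)]
  refine hlim.trans (le_of_eq (liminf_congr ?_))
  filter_upwards [eventually_ne_atTop 0] with N hN
  have hN' : (N : ℝ) ≠ 0 := by exact_mod_cast hN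
  rw [← hAK, EH_eq (by omega) (by omega) hA hAm hA1, Nat.add_sub_cancel,
    lintegral_emptyDensity_interior hA, ENNReal.toReal_mul, ENNReal.toReal_mul,
    ENNReal.toReal_natCast, ENNReal.toReal_natCast]
  field_simp
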